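/- Let a be a real zero of the Airy function, Ai(a) = 0. Then there exist w₀ > 0 and a function ϱ̃ : (0, w₀) → ℝ such that: (i) φ̃(ϱ̃(w), w) = 0 for all w ∈ (0, w₀); (ii) ϱ̃(w) = (1/(e·w))·( 1 − 2^{−1/3}·a·w^{2/3} − w/6 + O(w^{4/3}) ) as w → 0⁺; (iii) ∂_z φ̃(ϱ̃(w), w) ∼ −√(2π)·2^{2/3}·e^{11/12}·Ai'(a) · w^{1/6} · exp( −1/(2w) + 2^{−1/3}·a/w^{1/3} ) as w → 0⁺, where ∂_z denotes the partial derivative in the first variable. -/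

import Mathlib

open Filter Topology

/-- The contour `Π(π/3)`. -/
noncomputable def airyPath (φ : ℝ) (s : ℝ) : ℂ :=
  if s ≤ -1 then -Complex.exp (-(φ : ℂ) * Complex.I) * (s : ℂ)
  else if s ≤ 1 then (Real.cos φ : ℂ) + Complex.I * (s : ℂ) * (Real.sin φ : ℂ)
  else Complex.exp ((φ : ℂ) * Complex.I) * (s : ℂ)

/-- The piecewise derivative of the contour `Π(φ)`. -/
noncomputable def airyPathDeriv (φ : ℝ) (s : ℝ) : ℂ :=
  if s ≤ -1 then -Complex.exp (-(φ : ℂ) * Complex.I)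
  else if s ≤ 1 then Complex.I * (Real.sin φ : ℂ)
  else Complex.exp ((φ : ℂ) * Complex.I)

/-- The Airy function `Ai(z) = (1/(2πi)) ∫_{Π(π/3)} e^{−zt + t³/3} dt`. -/
noncomputable def airyAi (z : ℂ) : ℂ :=
  (1 / (2 * (Real.pi : ℂ) * Complex.I)) *
    ∫ s : ℝ, Complex.exp (-z * airyPath (Real.pi / 3) s + (airyPath (Real.pi / 3) s) ^ 3 / 3) *
      airyPathDeriv (Real.pi / 3) s

/-- The derivative `Ai'` of the Airy function. -/
noncomputable def airyAi' (z : ℂ) : ℂ := deriv airyAi z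

/-- The deformed exponential for simple digraphs:
`φ̃(z, w) = (2π log(1+w))^{−1/2} ∫_ℝ exp(−x²/(2 log(1+w)) − z √(1+w) e^{−ix}) dx`. -/
noncomputable def phiTilde (z : ℂ) (w : ℝ) : ℂ :=
  (1 / (Real.sqrt (2 * Real.pi * Real.log (1 + w)) : ℂ)) *
    ∫ x : ℝ, Complex.exp (-(x : ℂ) ^ 2 / (2 * (Real.log (1 + w) : ℂ))
      - z * (Real.sqrt (1 + w) : ℂ) * Complex.exp (-Complex.I * (x : ℂ)))

section

open MeasureTheory

/-- Taylor remainder bound for the complex exponential on a half-plane. -/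
theorem norm_exp_sub_sum_le_of_re_le {M : ℝ} (hM : 0 ≤ M) (n : ℕ) {u : ℂ} (hu : u.re ≤ M) :
    ‖Complex.exp u - ∑ k ∈ Finset.range n, u ^ k / (k.factorial : ℂ)‖ ≤
      Real.exp M * ‖u‖ ^ n := by
  induction n generalizing u with
  | zero => simpa [Complex.norm_exp] using hu
  | succ n ih =>
    have hder : ∀ z : ℂ, HasDerivAt
        (fun z => Complex.exp z - ∑ k ∈ Finset.range (n + 1), z ^ k / (k.factorial : ℂ))
        (Complex.exp z - ∑ k ∈ Finset.range n, z ^ k / (k.factorial : ℂ)) z := by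
      intro z
      refine (Complex.hasDerivAt_exp z).sub ?_
      simp only [Finset.sum_range_succ', pow_zero]
      apply HasDerivAt.add_const
      apply HasDerivAt.fun_sum
      intro k _
      refine ((hasDerivAt_pow (k + 1) z).div_const _).congr_deriv ?_
      have h1 : ((k : ℂ) + 1) ≠ 0 := Nat.cast_add_one_ne_zero k
      have h2 : (k.factorial : ℂ) ≠ 0 := Nat.cast_ne_zero.mpr k.factorial_ne_zero
      rw [Nat.factorial_succ]
      push_cast
      field_simp
    have hseg : ∀ z ∈ segment ℝ (0 : ℂ) u, z.re ≤ M ∧ ‖z‖ ≤ ‖u‖ := by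
      intro z hz
      rw [segment_eq_image] at hz
      obtain ⟨t, ⟨ht0, ht1⟩, rfl⟩ := hz
      constructor
      · simp only [smul_zero, zero_add, Complex.smul_re, smul_eq_mul]
        nlinarith
      · simp only [smul_zero, zero_add, norm_smul, Real.norm_eq_abs, abs_of_nonneg ht0]
        exact mul_le_of_le_one_left (norm_nonneg _) ht1
    have key := Convex.norm_image_sub_le_of_norm_hasDerivWithin_le
      (C := Real.exp M * ‖u‖ ^ n)
      (fun z _ => (hder z).hasDerivWithinAt (s := segment ℝ (0 : ℂ) u))
      (fun z hz => (ih (hseg z hz).1).trans (by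
        have := (hseg z hz).2
        gcongr))
      (convex_segment _ _) (left_mem_segment ℝ 0 u) (right_mem_segment ℝ 0 u)
    have h0 : Complex.exp (0 : ℂ) -
        ∑ k ∈ Finset.range (n + 1), (0 : ℂ) ^ k / (k.factorial : ℂ) = 0 := by
      simp [Finset.sum_range_succ']
    simp only [h0, sub_zero] at key
    rwa [pow_succ, ← mul_assoc]

theorem norm_exp_sub_sum_le_of_re_nonpos (n : ℕ) {u : ℂ} (hu : u.re ≤ 0) :
    ‖Complex.exp u - ∑ k ∈ Finset.range n, u ^ k / (k.factorial : ℂ)‖ ≤ ‖u‖ ^ n := by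
  simpa using norm_exp_sub_sum_le_of_re_le le_rfl n hu

theorem norm_exp_sub_one_sub_self_le (z : ℂ) :
    ‖Complex.exp z - 1 - z‖ ≤ ‖z‖ ^ 2 * (1 + ‖Complex.exp z‖) := by
  have h := norm_exp_sub_sum_le_of_re_le (le_max_left 0 z.re) 2 (le_max_right 0 z.re)
  have h1 : Complex.exp z - ∑ k ∈ Finset.range 2, z ^ k / (k.factorial : ℂ) =
      Complex.exp z - 1 - z := by
    simp [Finset.sum_range_succ]
    ring
  rw [h1] at h
  refine h.trans ?_
  rw [mul_comm, Complex.norm_exp]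
  gcongr
  rcases le_total z.re 0 with h0 | h0
  · rw [max_eq_left h0, Real.exp_zero]
    linarith [Real.exp_pos z.re]
  · rw [max_eq_right h0]
    linarith

/-- The integrals of an entire function over two infinite contours agree when the function decays
fast enough on the segments joining corresponding points of the contours. -/
theorem integral_comp_path_eq {F : ℂ → ℂ} (hF : Differentiable ℂ F) {γ₁ γ₂ γ₁' γ₂' : ℝ → ℂ}
    {N : Set ℝ} (hN : N.Countable) (hc₁ : Continuous γ₁) (hc₂ : Continuous γ₂)
    (hd₁ : ∀ x ∉ N, HasDerivAt γ₁ (γ₁' x) x) (hd₂ : ∀ x ∉ N, HasDerivAt γ₂ (γ₂' x) x)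
    (hi₁ : Integrable fun x => F (γ₁ x) * γ₁' x) (hi₂ : Integrable fun x => F (γ₂ x) * γ₂' x)
    {B : ℝ → ℝ} (hB : ∀ x, ∀ z ∈ segment ℝ (γ₁ x) (γ₂ x), ‖F z‖ ≤ B x)
    (htop : Tendsto (fun x => B x * ‖γ₂ x - γ₁ x‖) atTop (𝓝 0))
    (hbot : Tendsto (fun x => B x * ‖γ₂ x - γ₁ x‖) atBot (𝓝 0)) :
    ∫ x, F (γ₁ x) * γ₁' x = ∫ x, F (γ₂ x) * γ₂' x := by
  obtain ⟨H, hH⟩ := hF.isExactOn_univ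
  have hH' : ∀ z, HasDerivAt H (F z) z := fun z => hH z (Set.mem_univ z)
  have hHc : Continuous H := continuous_iff_continuousAt.mpr fun z => (hH' z).continuousAt
  have ftc : ∀ γ γ' : ℝ → ℂ, Continuous γ → (∀ x ∉ N, HasDerivAt γ (γ' x) x) →
      Integrable (fun x => F (γ x) * γ' x) → ∀ T : ℝ,
      ∫ x in (-T)..T, F (γ x) * γ' x = H (γ T) - H (γ (-T)) := by
    intro γ γ' hc hd hi T
    refine integral_eq_of_hasDerivAt_off_countable (fun x => H (γ x)) _ hN
      (hHc.comp hc).continuousOn (fun x hx => ?_) hi.intervalIntegrable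
    exact (hH' (γ x)).comp_of_eq x (hd x hx.2) rfl
  have hmv : ∀ x, ‖H (γ₂ x) - H (γ₁ x)‖ ≤ B x * ‖γ₂ x - γ₁ x‖ := fun x =>
    Convex.norm_image_sub_le_of_norm_hasDerivWithin_le
      (fun z _ => (hH' z).hasDerivWithinAt) (hB x) (convex_segment _ _)
      (left_mem_segment ℝ _ _) (right_mem_segment ℝ _ _)
  have hdt := squeeze_zero_norm hmv htop
  have hdb := (squeeze_zero_norm hmv hbot).comp tendsto_neg_atTop_atBot
  have l₁ := intervalIntegral_tendsto_integral hi₁ tendsto_neg_atTop_atBot tendsto_id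
  have l₂ := intervalIntegral_tendsto_integral hi₂ tendsto_neg_atTop_atBot tendsto_id
  have l₃ := l₂.sub l₁
  have l₄ := hdt.sub hdb
  rw [sub_zero] at l₄
  have := tendsto_nhds_unique l₃ (l₄.congr fun T => ?_)
  · exact (sub_eq_zero.mp this).symm
  · simp only [id_eq, Function.comp_apply]
    rw [ftc γ₁ γ₁' hc₁ hd₁ hi₁, ftc γ₂ γ₂' hc₂ hd₂ hi₂]
    ring

/-- The Gaussian majorant used for all contour integrals over vertical lines. -/
noncomputable def gaussDom (S τ : ℝ) : ℝ := Real.exp (S * (1 + |τ|) - τ ^ 2 / 4)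

theorem gaussDom_pos (S τ : ℝ) : 0 < gaussDom S τ := Real.exp_pos _

theorem gaussDom_le (S τ : ℝ) :
    gaussDom S τ ≤ Real.exp (S + 2 * S ^ 2) * Real.exp (-(1 / 8) * τ ^ 2) := by
  rw [gaussDom, ← Real.exp_add]
  refine Real.exp_le_exp.mpr ?_
  nlinarith [sq_nonneg (|τ| - 4 * S), sq_abs τ]

theorem continuous_gaussDom (S : ℝ) : Continuous (gaussDom S) := by
  unfold gaussDom
  fun_prop

theorem integrable_gaussDom (S : ℝ) : Integrable (gaussDom S) := by
  refine ((integrable_exp_neg_mul_sq (b := 1 / 8) (by norm_num)).const_mul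
    (Real.exp (S + 2 * S ^ 2))).mono' (continuous_gaussDom S).aestronglyMeasurable
    (Eventually.of_forall fun τ => ?_)
  rw [Real.norm_of_nonneg (gaussDom_pos S τ).le]
  exact gaussDom_le S τ

theorem tendsto_gaussDom (S : ℝ) {l : Filter ℝ} (hl : Tendsto (fun τ : ℝ => |τ|) l atTop) :
    Tendsto (gaussDom S) l (𝓝 0) := by
  refine squeeze_zero (fun τ => (gaussDom_pos S τ).le) (gaussDom_le S) ?_
  rw [← mul_zero (Real.exp (S + 2 * S ^ 2))]
  refine Tendsto.const_mul _ (Real.tendsto_exp_atBot.comp ?_)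
  have h : Tendsto (fun τ : ℝ => |τ| ^ 2) l atTop := (tendsto_pow_atTop two_ne_zero).comp hl
  simp only [sq_abs] at h
  exact h.const_mul_atTop_of_neg (by norm_num)

theorem pow_mul_gaussDom_le (n : ℕ) (S τ : ℝ) :
    (1 + |τ|) ^ n * gaussDom S τ ≤ n.factorial * gaussDom (S + 1) τ := by
  have h := Real.pow_div_factorial_le_exp (1 + |τ|) (by positivity) n
  have hf : (0 : ℝ) < n.factorial := by exact_mod_cast n.factorial_pos
  rw [div_le_iff₀ hf] at h
  calc (1 + |τ|) ^ n * gaussDom S τ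
      ≤ (Real.exp (1 + |τ|) * n.factorial) * gaussDom S τ := by
        have := (gaussDom_pos S τ).le
        gcongr
    _ = n.factorial * gaussDom (S + 1) τ := by
        rw [gaussDom, gaussDom, mul_right_comm, ← Real.exp_add, mul_comm]
        ring_nf

theorem airyPath_pi_div_three (x : ℝ) :
    airyPath (Real.pi / 3) x = ((max 1 |x| / 2 : ℝ) : ℂ) + ((√3 / 2 * x : ℝ) : ℂ) * Complex.I := by
  have hexp : Complex.exp (((Real.pi / 3 : ℝ) : ℂ) * Complex.I) =
      (1 / 2 : ℂ) + ((√3 / 2 : ℝ) : ℂ) * Complex.I := by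
    rw [Complex.exp_mul_I, ← Complex.ofReal_cos, ← Complex.ofReal_sin, Real.cos_pi_div_three,
      Real.sin_pi_div_three]
    push_cast
    ring
  have hexp' : Complex.exp (-((Real.pi / 3 : ℝ) : ℂ) * Complex.I) =
      (1 / 2 : ℂ) - ((√3 / 2 : ℝ) : ℂ) * Complex.I := by
    rw [← Complex.ofReal_neg, Complex.exp_mul_I, ← Complex.ofReal_cos, ← Complex.ofReal_sin,
      Real.cos_neg, Real.sin_neg, Real.cos_pi_div_three, Real.sin_pi_div_three]
    push_cast
    ring
  unfold airyPath
  split_ifs with h1 h2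
  · rw [hexp', abs_of_nonpos (by linarith), max_eq_right (by linarith)]
    push_cast
    ring
  · rw [max_eq_left (abs_le.mpr ⟨by linarith, h2⟩), Real.cos_pi_div_three, Real.sin_pi_div_three]
    push_cast
    ring
  · rw [hexp, abs_of_nonneg (by linarith), max_eq_right (by linarith)]
    push_cast
    ring

theorem continuous_airyPath : Continuous (airyPath (Real.pi / 3)) := by
  rw [show airyPath (Real.pi / 3) = _ from funext airyPath_pi_div_three]
  fun_prop

theorem hasDerivAt_airyPath {x : ℝ} (hx : x ∉ ({-1, 1} : Set ℝ)) :
    HasDerivAt (airyPath (Real.pi / 3)) (airyPathDeriv (Real.pi / 3) x) x := by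
  simp only [Set.mem_insert_iff, Set.mem_singleton_iff, not_or] at hx
  have hid : HasDerivAt (fun y : ℝ => (y : ℂ)) 1 x := Complex.ofRealCLM.hasDerivAt
  rcases lt_or_gt_of_ne hx.1 with h | h
  · rw [airyPathDeriv, if_pos h.le]
    refine ((hid.const_mul _).congr_deriv (mul_one _)).congr_of_eventuallyEq ?_
    filter_upwards [Iio_mem_nhds h] with y hy
    rw [airyPath, if_pos (le_of_lt hy)]
  · rcases lt_or_gt_of_ne hx.2 with h' | h'
    · rw [airyPathDeriv, if_neg (not_le.mpr h), if_pos h'.le]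
      refine ((((hid.const_mul Complex.I).mul_const (Real.sin (Real.pi / 3) : ℂ)).const_add
        (Real.cos (Real.pi / 3) : ℂ)).congr_deriv
        (by rw [mul_one])).congr_of_eventuallyEq ?_
      filter_upwards [Iio_mem_nhds h', Ioi_mem_nhds h] with y hy hy'
      rw [airyPath, if_neg (not_le.mpr hy'), if_pos (le_of_lt hy)]
    · rw [airyPathDeriv, if_neg (not_le.mpr h), if_neg (not_le.mpr h')]
      refine ((hid.const_mul _).congr_deriv (mul_one _)).congr_of_eventuallyEq ?_
      filter_upwards [Ioi_mem_nhds h', Ioi_mem_nhds h] with y hy hy'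
      rw [airyPath, if_neg (not_le.mpr hy'), if_neg (not_le.mpr hy)]

theorem measurable_airyPathDeriv (φ : ℝ) : Measurable (airyPathDeriv φ) :=
  Measurable.ite measurableSet_Iic measurable_const
    (Measurable.ite measurableSet_Iic measurable_const measurable_const)

theorem norm_airyPathDeriv_le (φ x : ℝ) : ‖airyPathDeriv φ x‖ ≤ 1 := by
  unfold airyPathDeriv
  split_ifs
  · rw [norm_neg, ← Complex.ofReal_neg, Complex.norm_exp_ofReal_mul_I]
  · rw [norm_mul, Complex.norm_I, one_mul, Complex.norm_real]
    exact Real.abs_sin_le_one φ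
  · rw [Complex.norm_exp_ofReal_mul_I]

/-- The Airy integrand is dominated by a Gaussian in the region between the contour
`Π(π/3)` and the vertical line of real part `1/2`. -/
theorem norm_exp_airy_le_of_region (ζ z : ℂ) {x : ℝ} (him : z.im = √3 / 2 * x)
    (hre : 1 / 2 ≤ z.re) (hre' : z.re ≤ max 1 |x| / 2) :
    ‖Complex.exp (-ζ * z + z ^ 3 / 3)‖ ≤ Real.exp 1 * gaussDom (2 * ‖ζ‖) x := by
  rw [Complex.norm_exp, gaussDom, ← Real.exp_add]
  refine Real.exp_le_exp.mpr ?_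
  have h3 : √3 ^ 2 = 3 := Real.sq_sqrt (by norm_num)
  have h3' : √3 ≤ 2 := by nlinarith [Real.sqrt_nonneg 3]
  have hmax : max 1 |x| ≤ 1 + |x| := max_le (by linarith [abs_nonneg x]) (by linarith)
  have hz : ‖z‖ ≤ 2 * (1 + |x|) := by
    refine (Complex.norm_le_abs_re_add_abs_im z).trans ?_
    rw [him, abs_of_nonneg (by linarith : 0 ≤ z.re), abs_mul,
      abs_of_nonneg (by positivity : 0 ≤ √3 / 2)]
    nlinarith [abs_nonneg x]
  have hlin : (-ζ * z).re ≤ 2 * ‖ζ‖ * (1 + |x|) := by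
    refine (Complex.re_le_norm _).trans ?_
    rw [norm_mul, norm_neg]
    nlinarith [norm_nonneg ζ]
  have hcube : (z ^ 3 / 3).re = z.re ^ 3 / 3 - z.re * z.im ^ 2 := by
    have : z ^ 3 / 3 = z ^ 3 * ((1 / 3 : ℝ) : ℂ) := by push_cast; ring
    rw [this, Complex.re_mul_ofReal]
    simp only [pow_succ, pow_zero, one_mul, Complex.mul_re, Complex.mul_im]
    ring
  have him2 : z.im ^ 2 = 3 / 4 * x ^ 2 := by
    rw [him, mul_pow, div_pow, h3]
    ring
  have hcube' : z.re ^ 3 / 3 - z.re * z.im ^ 2 ≤ 1 - x ^ 2 / 4 := by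
    rw [him2]
    rcases le_total |x| 1 with h | h
    · rw [max_eq_left h] at hre'
      have : z.re = 1 / 2 := le_antisymm hre' hre
      rw [this]
      nlinarith [sq_nonneg x]
    · rw [max_eq_right h] at hre'
      have : z.re ^ 2 ≤ x ^ 2 / 4 := by
        rw [← sq_abs x]
        nlinarith
      nlinarith [sq_nonneg x]
  rw [Complex.add_re, hcube]
  linarith

/-- The vertical line of real part `1/2`. -/
noncomputable def vline (τ : ℝ) : ℂ := 1 / 2 + (τ : ℂ) * Complex.I

@[simp] theorem vline_re (τ : ℝ) : (vline τ).re = 1 / 2 := by simp [vline]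

@[simp] theorem vline_im (τ : ℝ) : (vline τ).im = τ := by simp [vline]

theorem continuous_vline : Continuous vline := by
  unfold vline
  fun_prop

theorem hasDerivAt_vline (τ : ℝ) : HasDerivAt vline Complex.I τ := by
  have hid : HasDerivAt (fun y : ℝ => (y : ℂ)) 1 τ := Complex.ofRealCLM.hasDerivAt
  exact ((hid.mul_const Complex.I).const_add _).congr_deriv (one_mul _)

theorem norm_vline_le (τ : ℝ) : ‖vline τ‖ ≤ 1 + |τ| := by
  refine (Complex.norm_le_abs_re_add_abs_im _).trans ?_
  rw [vline_re, vline_im, abs_of_pos (by norm_num : (0 : ℝ) < 1 / 2)]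
  linarith

/-- The Airy integrand on the vertical line. -/
noncomputable def airyKernel (s : ℂ) (τ : ℝ) : ℂ :=
  Complex.exp (-s * vline τ + vline τ ^ 3 / 3)

theorem continuous_airyKernel (s : ℂ) : Continuous (airyKernel s) := by
  have := continuous_vline
  unfold airyKernel
  fun_prop

theorem norm_airyKernel_le {s : ℂ} {S : ℝ} (hs : ‖s‖ ≤ S) (τ : ℝ) :
    ‖airyKernel s τ‖ ≤ Real.exp 1 * gaussDom S τ := by
  rw [airyKernel, Complex.norm_exp, gaussDom, ← Real.exp_add]
  refine Real.exp_le_exp.mpr ?_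
  have hlin : (-s * vline τ).re ≤ S * (1 + |τ|) := by
    refine (Complex.re_le_norm _).trans ?_
    rw [norm_mul, norm_neg]
    have := norm_vline_le τ
    have := (norm_nonneg s).trans hs
    gcongr
  have hcube : (vline τ ^ 3 / 3).re = 1 / 24 - τ ^ 2 / 2 := by
    have : vline τ ^ 3 / 3 = vline τ ^ 3 * ((1 / 3 : ℝ) : ℂ) := by push_cast; ring
    rw [this, Complex.re_mul_ofReal]
    simp only [pow_succ, pow_zero, one_mul, Complex.mul_re, Complex.mul_im, vline_re, vline_im]
    ring
  rw [Complex.add_re, hcube]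
  nlinarith [sq_nonneg τ]

theorem airyAi_eq_integral_vline (ζ : ℂ) :
    airyAi ζ = 1 / (2 * (Real.pi : ℂ)) * ∫ τ, airyKernel ζ τ := by
  set F : ℂ → ℂ := fun z => Complex.exp (-ζ * z + z ^ 3 / 3) with hFdef
  have hF : Differentiable ℂ F := by
    rw [hFdef]
    fun_prop
  set γ : ℝ → ℂ := fun x => vline (√3 / 2 * x) with hγ
  have hγc : Continuous γ := continuous_vline.comp (by fun_prop)
  have hγd : ∀ x, HasDerivAt γ (((√3 / 2 : ℝ) : ℂ) * Complex.I) x := by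
    intro x
    have h1 : HasDerivAt (fun y : ℝ => √3 / 2 * y) (√3 / 2) x := by
      simpa using (hasDerivAt_id x).const_mul (√3 / 2)
    have := (hasDerivAt_vline (√3 / 2 * x)).scomp x h1
    refine this.congr_deriv ?_
    rw [Complex.real_smul]
  have hmax1 : ∀ x : ℝ, 1 / 2 ≤ max 1 |x| / 2 := fun x => by
    linarith [le_max_left 1 |x|]
  have hre : ∀ x, (airyPath (Real.pi / 3) x).re = max 1 |x| / 2 := fun x => by
    rw [airyPath_pi_div_three]
    simp only [Complex.add_re, Complex.ofReal_re, Complex.mul_re, Complex.I_re,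
      Complex.ofReal_im, Complex.I_im]
    ring
  have him : ∀ x, (airyPath (Real.pi / 3) x).im = √3 / 2 * x := fun x => by
    rw [airyPath_pi_div_three]
    simp only [Complex.add_im, Complex.ofReal_re, Complex.mul_im, Complex.I_re,
      Complex.ofReal_im, Complex.I_im]
    ring
  have hb : ∀ x, ∀ z ∈ segment ℝ (airyPath (Real.pi / 3) x) (γ x),
      ‖F z‖ ≤ Real.exp 1 * gaussDom (2 * ‖ζ‖) x := by
    intro x z hz
    obtain ⟨p, q, hp, hq, hpq, rfl⟩ := hz
    have hi : (p • airyPath (Real.pi / 3) x + q • γ x).im = √3 / 2 * x := by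
      simp only [hγ, Complex.add_im, Complex.smul_im, him, vline_im, smul_eq_mul]
      rw [← add_mul, hpq, one_mul]
    have hr : (p • airyPath (Real.pi / 3) x + q • γ x).re =
        p * (max 1 |x| / 2) + q * (1 / 2) := by
      simp only [hγ, Complex.add_re, Complex.smul_re, hre, vline_re, smul_eq_mul]
    refine norm_exp_airy_le_of_region ζ _ hi ?_ ?_ <;> rw [hr] <;> nlinarith [hmax1 x]
  have hdom : Integrable fun x => Real.exp 1 * gaussDom (2 * ‖ζ‖) x :=
    (integrable_gaussDom _).const_mul _
  have hi₁ : Integrable fun x => F (airyPath (Real.pi / 3) x) * airyPathDeriv (Real.pi / 3) x := by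
    refine hdom.mono' ((hF.continuous.comp continuous_airyPath).aestronglyMeasurable.mul
      (measurable_airyPathDeriv _).aestronglyMeasurable) (Eventually.of_forall fun x => ?_)
    rw [norm_mul]
    calc _ ≤ (Real.exp 1 * gaussDom (2 * ‖ζ‖) x) * 1 :=
          mul_le_mul (hb x _ (left_mem_segment ℝ _ _)) (norm_airyPathDeriv_le _ _)
            (norm_nonneg _) (mul_nonneg (Real.exp_pos _).le (gaussDom_pos _ _).le)
      _ = _ := mul_one _
  have hi₂ : Integrable fun x => F (γ x) * (((√3 / 2 : ℝ) : ℂ) * Complex.I) :=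
    (hdom.mono' (hF.continuous.comp hγc).aestronglyMeasurable
      (Eventually.of_forall fun x => hb x _ (right_mem_segment ℝ _ _))).mul_const _
  have hdist : ∀ x, ‖γ x - airyPath (Real.pi / 3) x‖ ≤ 1 + |x| := by
    intro x
    have h : γ x - airyPath (Real.pi / 3) x = ((1 / 2 - max 1 |x| / 2 : ℝ) : ℂ) := by
      apply Complex.ext
      · rw [Complex.sub_re, hre, hγ, vline_re, Complex.ofReal_re]
      · rw [Complex.sub_im, him, hγ, vline_im, Complex.ofReal_im, sub_self]
    rw [h, Complex.norm_real, Real.norm_eq_abs, abs_le]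
    have := max_le_iff.mp (le_refl (max 1 |x|))
    have hm : max 1 |x| ≤ 1 + |x| := max_le (by linarith [abs_nonneg x]) (by linarith)
    constructor <;> linarith [abs_nonneg x]
  have hlim : ∀ l : Filter ℝ, Tendsto (fun τ : ℝ => |τ|) l atTop →
      Tendsto (fun x => Real.exp 1 * gaussDom (2 * ‖ζ‖) x * ‖γ x - airyPath (Real.pi / 3) x‖)
        l (𝓝 0) := by
    intro l hl
    refine squeeze_zero (fun x => ?_) (fun x => ?_)
      (by simpa using (tendsto_gaussDom (2 * ‖ζ‖ + 1) hl).const_mul (Real.exp 1))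
    · exact mul_nonneg (mul_nonneg (Real.exp_pos _).le (gaussDom_pos _ _).le) (norm_nonneg _)
    · rw [mul_assoc]
      have h1 := pow_mul_gaussDom_le 1 (2 * ‖ζ‖) x
      simp only [pow_one, Nat.factorial_one, Nat.cast_one, one_mul] at h1
      have h2 := mul_le_mul_of_nonneg_left (hdist x) (gaussDom_pos (2 * ‖ζ‖) x).le
      have := (Real.exp_pos 1).le
      gcongr
      linarith
  have hmain := integral_comp_path_eq hF (N := {-1, 1}) (Set.toFinite _).countable
    continuous_airyPath hγc (fun x hx => hasDerivAt_airyPath hx) (fun x _ => hγd x) hi₁ hi₂ hb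
    (hlim _ tendsto_abs_atTop_atTop) (hlim _ tendsto_abs_atBot_atTop)
  have hscale := Measure.integral_comp_mul_left (airyKernel ζ) (√3 / 2)
  have hs3 : (0 : ℝ) < √3 / 2 := by positivity
  have hs3' : ((√3 / 2 : ℝ) : ℂ) ≠ 0 := Complex.ofReal_ne_zero.mpr hs3.ne'
  rw [abs_of_pos (inv_pos.mpr hs3), Complex.real_smul, Complex.ofReal_inv] at hscale
  rw [airyAi]
  change _ * ∫ s, F (airyPath (Real.pi / 3) s) * airyPathDeriv (Real.pi / 3) s = _
  rw [hmain, integral_mul_const]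
  change _ * ((∫ x, airyKernel ζ (√3 / 2 * x)) * _) = _
  rw [hscale]
  have hpi : (Real.pi : ℂ) ≠ 0 := Complex.ofReal_ne_zero.mpr Real.pi_ne_zero
  field_simp

theorem norm_pow_mul_airyKernel_le (n : ℕ) {s : ℂ} {S : ℝ} (hs : ‖s‖ ≤ S) (τ : ℝ) :
    ‖vline τ ^ n * airyKernel s τ‖ ≤ Real.exp 1 * n.factorial * gaussDom (S + 1) τ := by
  rw [norm_mul, norm_pow]
  calc ‖vline τ‖ ^ n * ‖airyKernel s τ‖
      ≤ (1 + |τ|) ^ n * (Real.exp 1 * gaussDom S τ) := by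
        gcongr
        · exact norm_vline_le τ
        · exact norm_airyKernel_le hs τ
    _ = Real.exp 1 * ((1 + |τ|) ^ n * gaussDom S τ) := by ring
    _ ≤ Real.exp 1 * (n.factorial * gaussDom (S + 1) τ) := by
        have := (Real.exp_pos 1).le
        have := pow_mul_gaussDom_le n S τ
        gcongr
    _ = _ := by ring

theorem integrable_pow_mul_airyKernel (n : ℕ) (s : ℂ) :
    Integrable fun τ => vline τ ^ n * airyKernel s τ := by
  refine ((integrable_gaussDom (‖s‖ + 1)).const_mul (Real.exp 1 * n.factorial)).mono'
    ((continuous_vline.pow n).mul (continuous_airyKernel s)).aestronglyMeasurable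
    (Eventually.of_forall fun τ => ?_)
  exact norm_pow_mul_airyKernel_le n le_rfl τ

/-- The moments `∫ pⁿ exp(-s p + p³/3) dτ` along the vertical line `p = 1/2 + iτ`. -/
noncomputable def airyMoment (n : ℕ) (s : ℂ) : ℂ := ∫ τ, vline τ ^ n * airyKernel s τ

theorem hasDerivAt_airyMoment (n : ℕ) (s : ℂ) :
    HasDerivAt (airyMoment n) (-airyMoment (n + 1) s) s := by
  have h := hasDerivAt_integral_of_dominated_loc_of_deriv_le (μ := volume)
    (F := fun s τ => vline τ ^ n * airyKernel s τ)
    (F' := fun s τ => -(vline τ ^ (n + 1) * airyKernel s τ))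
    (bound := fun τ => Real.exp 1 * (n + 1).factorial * gaussDom (‖s‖ + 1 + 1) τ)
    (Metric.ball_mem_nhds s one_pos)
    (Eventually.of_forall fun z => (integrable_pow_mul_airyKernel n z).aestronglyMeasurable)
    (integrable_pow_mul_airyKernel n s)
    (integrable_pow_mul_airyKernel (n + 1) s).neg.aestronglyMeasurable
    (Eventually.of_forall fun τ z hz => ?_)
    ((integrable_gaussDom _).const_mul _)
    (Eventually.of_forall fun τ z _ => ?_)
  · have h2 := h.2
    rw [integral_neg] at h2
    exact h2
  · rw [norm_neg]
    refine norm_pow_mul_airyKernel_le (n + 1) ?_ τ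
    have := norm_sub_norm_le z s
    rw [Metric.mem_ball, dist_eq_norm] at hz
    linarith
  · have h1 : HasDerivAt (fun z : ℂ => -z * vline τ + vline τ ^ 3 / 3) (-1 * vline τ) z :=
      ((hasDerivAt_id z).neg.mul_const (vline τ)).add_const _
    refine ((h1.cexp).const_mul (vline τ ^ n)).congr_deriv ?_
    rw [airyKernel]
    ring

theorem airyMoment_add_two (n : ℕ) (s : ℂ) :
    airyMoment (n + 2) s = s * airyMoment n s - n * airyMoment (n - 1) s := by
  have hd : ∀ τ, HasDerivAt (fun τ => vline τ ^ n * airyKernel s τ)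
      (Complex.I * (n * (vline τ ^ (n - 1) * airyKernel s τ) +
        vline τ ^ (n + 2) * airyKernel s τ - s * (vline τ ^ n * airyKernel s τ))) τ := by
    intro τ
    have hv := hasDerivAt_vline τ
    have h1 : HasDerivAt (fun τ => -s * vline τ + vline τ ^ 3 / 3)
        (-s * Complex.I + (3 : ℕ) * vline τ ^ (3 - 1) * Complex.I / 3) τ :=
      (hv.const_mul (-s)).add ((hv.fun_pow 3).div_const 3)
    refine ((hv.fun_pow n).mul h1.cexp).congr_deriv ?_
    rw [airyKernel]
    push_cast
    ring
  have hi0 := integrable_pow_mul_airyKernel n s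
  have hi1 := (integrable_pow_mul_airyKernel (n - 1) s).const_mul (n : ℂ)
  have hi2 := integrable_pow_mul_airyKernel (n + 2) s
  have hi3 : Integrable fun τ => n * (vline τ ^ (n - 1) * airyKernel s τ) +
      vline τ ^ (n + 2) * airyKernel s τ := hi1.add hi2
  have h := integral_eq_zero_of_hasDerivAt_of_integrable hd
    ((hi3.sub (hi0.const_mul s)).const_mul Complex.I) hi0
  rw [integral_const_mul, integral_sub hi3 (hi0.const_mul s),
    integral_add hi1 hi2, integral_const_mul, integral_const_mul] at h
  have h' := (mul_eq_zero.mp h).resolve_left Complex.I_ne_zero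
  unfold airyMoment
  linear_combination h'

theorem airyAi_eq_airyMoment (s : ℂ) : airyAi s = 1 / (2 * (Real.pi : ℂ)) * airyMoment 0 s := by
  rw [airyAi_eq_integral_vline, airyMoment]
  simp only [pow_zero, one_mul]

theorem airyAi'_eq_airyMoment (s : ℂ) :
    airyAi' s = -(1 / (2 * (Real.pi : ℂ)) * airyMoment 1 s) := by
  have h := ((hasDerivAt_airyMoment 0 s).const_mul (1 / (2 * (Real.pi : ℂ)))).deriv
  rw [airyAi', show airyAi = _ from funext airyAi_eq_airyMoment, h]
  ring

theorem exists_airyMoment_zero_ne_zero : ∃ t : ℝ, airyMoment 0 (t : ℂ) ≠ 0 := by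
  by_contra! hzero
  have hcont := continuous_airyKernel 0
  have hker : Integrable (airyKernel 0) := by
    simpa using integrable_pow_mul_airyKernel 0 0
  have hF : FourierTransform.fourier (airyKernel 0) = 0 := by
    ext ξ
    have h := hzero (2 * Real.pi * ξ)
    rw [airyMoment] at h
    have hk : ∀ τ, vline τ ^ 0 * airyKernel ((2 * Real.pi * ξ : ℝ) : ℂ) τ =
        Complex.exp (-(Real.pi : ℂ) * ξ) *
          (Complex.exp (((-2 * Real.pi * τ * ξ : ℝ) : ℂ) * Complex.I) • airyKernel 0 τ) := by
      intro τ
      rw [smul_eq_mul, airyKernel, airyKernel, ← Complex.exp_add, ← Complex.exp_add, pow_zero,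
        one_mul]
      congr 1
      rw [vline]
      push_cast
      ring
    simp only [hk] at h
    rw [integral_const_mul] at h
    rw [Real.fourier_real_eq_integral_exp_smul]
    exact (mul_eq_zero.mp h).resolve_left (Complex.exp_ne_zero _)
  have hinv := hcont.fourierInv_fourier_eq hker (by rw [hF]; exact integrable_zero _ _ _)
  rw [hF] at hinv
  have h0 := congrFun hinv 0
  rw [Real.fourierInv_eq'] at h0
  simp only [Pi.zero_apply, smul_zero, integral_zero] at h0
  exact Complex.exp_ne_zero _ h0.symm

theorem airyMoment_one_ne_zero {a : ℝ} (ha : airyMoment 0 (a : ℂ) = 0) :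
    airyMoment 1 (a : ℂ) ≠ 0 := by
  intro h1
  obtain ⟨t, ht⟩ := exists_airyMoment_zero_ne_zero
  refine ht ?_
  set R : ℝ := |a| + |t| + 1 with hR
  set f : ℝ → ℂ × ℂ := fun x => (airyMoment 0 x, airyMoment 1 x) with hf
  set v : ℝ → ℂ × ℂ → ℂ × ℂ := fun x y => (-y.2, -((x : ℂ) * y.1)) with hv
  have hfd : ∀ x, HasDerivAt f (v x (f x)) x := by
    intro x
    have e0 := (hasDerivAt_airyMoment 0 (x : ℂ)).comp_ofReal
    have e1 := (hasDerivAt_airyMoment 1 (x : ℂ)).comp_ofReal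
    have e2 := airyMoment_add_two 0 (x : ℂ)
    simp only [zero_add, Nat.cast_zero, zero_mul, sub_zero] at e2
    rw [show 1 + 1 = 2 from rfl, e2] at e1
    exact e0.prodMk e1
  have hfc : Continuous f := continuous_iff_continuousAt.mpr fun x => (hfd x).continuousAt
  have hlip : ∀ x ∈ Set.Ioo (-R) R, LipschitzOnWith ⟨1 + R, by positivity⟩ (v x) Set.univ := by
    intro x hx
    refine (LipschitzWith.of_dist_le_mul fun y z => ?_).lipschitzOnWith
    rw [dist_eq_norm, dist_eq_norm]
    have hx' : |x| ≤ 1 + R := by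
      have := abs_lt.mpr hx
      linarith
    change ‖v x y - v x z‖ ≤ (1 + R) * ‖y - z‖
    rw [Prod.norm_def]
    refine max_le ?_ ?_
    · have : (v x y - v x z).1 = -(y - z).2 := by simp [hv]; ring
      rw [this, norm_neg]
      have h2 := norm_snd_le (y - z)
      have : 0 ≤ R := by positivity
      nlinarith [norm_nonneg (y - z)]
    · have : (v x y - v x z).2 = -((x : ℂ) * (y - z).1) := by simp [hv]; ring
      rw [this, norm_neg, norm_mul, Complex.norm_real, Real.norm_eq_abs]
      have h2 := norm_fst_le (y - z)
      gcongr
  have hzero : ∀ x : ℝ, HasDerivAt (fun _ : ℝ => (0 : ℂ × ℂ)) (v x 0) x := by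
    intro x
    refine (hasDerivAt_const x (0 : ℂ × ℂ)).congr_deriv ?_
    ext <;> simp [hv]
  have ha' : a ∈ Set.Ioo (-R) R := by
    rw [Set.mem_Ioo, ← abs_lt]
    linarith [abs_nonneg t]
  have heq := ODE_solution_unique_of_mem_Icc (s := fun _ => Set.univ) hlip ha' hfc.continuousOn
    (fun x _ => hfd x) (fun _ _ => Set.mem_univ _) continuousOn_const
    (fun x _ => hzero x) (fun _ _ => Set.mem_univ _) (by simp [hf, ha, h1])
  have htm : t ∈ Set.Icc (-R) R := by
    rw [Set.mem_Icc, ← abs_le]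
    linarith [abs_nonneg a]
  exact congrArg Prod.fst (heq htm)

/-- The exponent of the rescaled integrand of the deformed exponential on the vertical line. -/
noncomputable def dagExponent (s : ℂ) (κ τ : ℝ) : ℂ :=
  -(2 / (κ : ℂ) ^ 3) * (Complex.exp (-κ * vline τ) - 1 - (-κ * vline τ) - (-κ * vline τ) ^ 2 / 2) +
    s * ((Complex.exp (-κ * vline τ) - 1) / κ)

theorem continuous_dagExponent (s : ℂ) (κ : ℝ) : Continuous (dagExponent s κ) := by
  have := continuous_vline
  unfold dagExponent
  fun_prop

theorem neg_mul_vline_re (κ τ : ℝ) : (-κ * vline τ).re = -(κ / 2) := by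
  simp only [← Complex.ofReal_neg, Complex.re_ofReal_mul, vline_re]
  ring

theorem neg_mul_vline_im (κ τ : ℝ) : (-κ * vline τ).im = -(κ * τ) := by
  simp only [← Complex.ofReal_neg, Complex.im_ofReal_mul, vline_im]
  ring

theorem norm_exp_neg_mul_vline_sub_sum_le {κ : ℝ} (hκ : 0 ≤ κ) (τ : ℝ) (n : ℕ) :
    ‖Complex.exp (-κ * vline τ) - ∑ k ∈ Finset.range n, (-κ * vline τ) ^ k / (k.factorial : ℂ)‖ ≤
      κ ^ n * ‖vline τ‖ ^ n := by
  refine (norm_exp_sub_sum_le_of_re_nonpos n ?_).trans ?_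
  · rw [neg_mul_vline_re]
    linarith
  · rw [norm_mul, norm_neg, Complex.norm_real, Real.norm_of_nonneg hκ, mul_pow]

theorem norm_exp_neg_mul_vline_sub_one_div_le {κ : ℝ} (hκ : 0 < κ) (τ : ℝ) :
    ‖(Complex.exp (-κ * vline τ) - 1) / κ‖ ≤ 1 + |τ| := by
  have h := norm_exp_neg_mul_vline_sub_sum_le hκ.le τ 1
  simp only [Finset.sum_range_one, pow_zero, Nat.factorial_zero, Nat.cast_one, div_one,
    pow_one] at h
  rw [norm_div, Complex.norm_real, Real.norm_of_nonneg hκ.le, div_le_iff₀ hκ]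
  nlinarith [norm_vline_le τ]

theorem abs_exp_sub_sum_le_of_nonpos (n : ℕ) {x : ℝ} (hx : x ≤ 0) :
    |Real.exp x - ∑ k ∈ Finset.range n, x ^ k / (k.factorial : ℝ)| ≤ |x| ^ n := by
  have h := norm_exp_sub_sum_le_of_re_nonpos n (u := (x : ℂ)) (by simpa using hx)
  rw [Complex.norm_real, Real.norm_eq_abs] at h
  rw [← Real.norm_eq_abs (_ - _), ← Complex.norm_real]
  push_cast
  exact h

theorem norm_exp_dagExponent_le {s : ℂ} {S κ : ℝ} (hs : ‖s‖ ≤ S) (hκ : 0 < κ) (hκ1 : κ ≤ 1)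
    (τ : ℝ) : ‖Complex.exp (dagExponent s κ τ)‖ ≤ Real.exp 1 * gaussDom S τ := by
  rw [Complex.norm_exp, gaussDom, ← Real.exp_add]
  refine Real.exp_le_exp.mpr ?_
  have hlin : (s * ((Complex.exp (-κ * vline τ) - 1) / κ)).re ≤ S * (1 + |τ|) := by
    refine (Complex.re_le_norm _).trans ?_
    rw [norm_mul]
    have := norm_exp_neg_mul_vline_sub_one_div_le hκ τ
    have := (norm_nonneg s).trans hs
    gcongr
  set ρ := Real.exp (-(κ / 2)) with hρ
  have hρ0 : 0 < ρ := Real.exp_pos _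
  have h2 := abs_exp_sub_sum_le_of_nonpos 2 (x := -(κ / 2)) (by linarith)
  have h3 := abs_exp_sub_sum_le_of_nonpos 3 (x := -(κ / 2)) (by linarith)
  simp only [Finset.sum_range_succ, Finset.sum_range_zero, pow_zero, Nat.factorial_zero,
    Nat.cast_one, pow_one, Nat.factorial_one, Nat.factorial_two, Nat.cast_ofNat, abs_neg,
    abs_of_pos (half_pos hκ), ← hρ] at h2 h3
  rw [abs_le] at h2 h3
  have hcos := Real.one_sub_sq_div_two_le_cos (x := κ * τ)
  have hρcos : ρ * (1 - (κ * τ) ^ 2 / 2) ≤ ρ * Real.cos (κ * τ) := by gcongr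
  have hmain : κ ^ 3 / 2 * (τ ^ 2 / 4 - 1) ≤
      ρ * Real.cos (κ * τ) - 1 + κ / 2 - (κ ^ 2 / 4 - κ ^ 2 * τ ^ 2) / 2 := by
    have hT : 0 ≤ κ ^ 2 * τ ^ 2 := by positivity
    have hgap : κ / 4 ≤ 1 - ρ := by nlinarith
    have hprod := mul_le_mul_of_nonneg_left hgap hT
    have hk3 : 0 < κ ^ 3 := by positivity
    nlinarith
  have hre : (-(2 / (κ : ℂ) ^ 3) * (Complex.exp (-κ * vline τ) - 1 - (-κ * vline τ) -
      (-κ * vline τ) ^ 2 / 2)).re = -(2 / κ ^ 3) *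
        (ρ * Real.cos (κ * τ) - 1 + κ / 2 - (κ ^ 2 / 4 - κ ^ 2 * τ ^ 2) / 2) := by
    have hc : -(2 / (κ : ℂ) ^ 3) = ((-(2 / κ ^ 3) : ℝ) : ℂ) := by push_cast; ring
    have hsq : ((-κ * vline τ) ^ 2 / 2).re = (κ ^ 2 / 4 - κ ^ 2 * τ ^ 2) / 2 := by
      have : (-κ * vline τ) ^ 2 / 2 = (-κ * vline τ) ^ 2 * ((1 / 2 : ℝ) : ℂ) := by push_cast; ring
      rw [this, Complex.re_mul_ofReal, pow_two, Complex.mul_re, neg_mul_vline_re, neg_mul_vline_im]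
      ring
    rw [hc, Complex.re_ofReal_mul, Complex.sub_re, Complex.sub_re, Complex.sub_re, hsq,
      Complex.exp_re, neg_mul_vline_re, neg_mul_vline_im, Real.cos_neg, Complex.one_re, ← hρ]
    ring
  have hquad : -(2 / κ ^ 3) *
      (ρ * Real.cos (κ * τ) - 1 + κ / 2 - (κ ^ 2 / 4 - κ ^ 2 * τ ^ 2) / 2) ≤ 1 - τ ^ 2 / 4 := by
    have hk3 : 0 < 2 / κ ^ 3 := by positivity
    have := mul_le_mul_of_nonneg_left hmain hk3.le
    have hid : 2 / κ ^ 3 * (κ ^ 3 / 2 * (τ ^ 2 / 4 - 1)) = τ ^ 2 / 4 - 1 := by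
      field_simp
    linarith
  rw [dagExponent, Complex.add_re, hre]
  linarith

theorem integrable_exp_dagExponent (s : ℂ) {κ : ℝ} (hκ : 0 < κ) (hκ1 : κ ≤ 1) :
    Integrable fun τ => Complex.exp (dagExponent s κ τ) :=
  ((integrable_gaussDom ‖s‖).const_mul (Real.exp 1)).mono'
    (continuous_dagExponent s κ).cexp.aestronglyMeasurable
    (Eventually.of_forall fun τ => norm_exp_dagExponent_le le_rfl hκ hκ1 τ)

/-- The rescaled integral of the deformed exponential. -/
noncomputable def dagIntegral (s : ℂ) (κ : ℝ) : ℂ := ∫ τ, Complex.exp (dagExponent s κ τ)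

/-- The derivative of `dagIntegral` in the first variable. -/
noncomputable def dagIntegralDeriv (s : ℂ) (κ : ℝ) : ℂ :=
  ∫ τ, (Complex.exp (-κ * vline τ) - 1) / κ * Complex.exp (dagExponent s κ τ)

theorem continuous_dagIntegralDeriv_integrand (s : ℂ) (κ : ℝ) :
    Continuous fun τ => (Complex.exp (-κ * vline τ) - 1) / κ * Complex.exp (dagExponent s κ τ) := by
  have := continuous_vline
  have := continuous_dagExponent s κ
  fun_prop

theorem norm_dagIntegralDeriv_integrand_le {s : ℂ} {S κ : ℝ} (hs : ‖s‖ ≤ S) (hκ : 0 < κ)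
    (hκ1 : κ ≤ 1) (τ : ℝ) :
    ‖(Complex.exp (-κ * vline τ) - 1) / κ * Complex.exp (dagExponent s κ τ)‖ ≤
      Real.exp 1 * gaussDom (S + 1) τ := by
  rw [norm_mul]
  have h1 := pow_mul_gaussDom_le 1 S τ
  simp only [pow_one, Nat.factorial_one, Nat.cast_one, one_mul] at h1
  calc _ ≤ (1 + |τ|) * (Real.exp 1 * gaussDom S τ) := by
        gcongr
        · exact norm_exp_neg_mul_vline_sub_one_div_le hκ τ
        · exact norm_exp_dagExponent_le hs hκ hκ1 τ
    _ = Real.exp 1 * ((1 + |τ|) * gaussDom S τ) := by ring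
    _ ≤ _ := by
        have := (Real.exp_pos 1).le
        gcongr

theorem hasDerivAt_dagIntegral (s : ℂ) {κ : ℝ} (hκ : 0 < κ) (hκ1 : κ ≤ 1) :
    HasDerivAt (fun s => dagIntegral s κ) (dagIntegralDeriv s κ) s := by
  refine (hasDerivAt_integral_of_dominated_loc_of_deriv_le (μ := volume)
    (F := fun s τ => Complex.exp (dagExponent s κ τ))
    (F' := fun s τ => (Complex.exp (-κ * vline τ) - 1) / κ * Complex.exp (dagExponent s κ τ))
    (bound := fun τ => Real.exp 1 * gaussDom (‖s‖ + 1 + 1) τ)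
    (Metric.ball_mem_nhds s one_pos)
    (Eventually.of_forall fun z => (integrable_exp_dagExponent z hκ hκ1).aestronglyMeasurable)
    (integrable_exp_dagExponent s hκ hκ1)
    (continuous_dagIntegralDeriv_integrand s κ).aestronglyMeasurable
    (Eventually.of_forall fun τ z hz => ?_)
    ((integrable_gaussDom _).const_mul _)
    (Eventually.of_forall fun τ z _ => ?_)).2
  · refine norm_dagIntegralDeriv_integrand_le ?_ hκ hκ1 τ
    have := norm_sub_norm_le z s
    rw [Metric.mem_ball, dist_eq_norm] at hz
    linarith
  · have h1 : HasDerivAt (fun z : ℂ => dagExponent z κ τ)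
        (1 * ((Complex.exp (-κ * vline τ) - 1) / κ)) z :=
      ((hasDerivAt_id z).mul_const _).const_add _
    refine h1.cexp.congr_deriv ?_
    ring

theorem norm_exp_sub_one_div_add_le {κ : ℝ} (hκ : 0 < κ) (τ : ℝ) :
    ‖(Complex.exp (-κ * vline τ) - 1) / κ + vline τ‖ ≤ κ * ‖vline τ‖ ^ 2 := by
  have h := norm_exp_neg_mul_vline_sub_sum_le hκ.le τ 2
  have hκ' : (κ : ℂ) ≠ 0 := Complex.ofReal_ne_zero.mpr hκ.ne'
  have e : (Complex.exp (-κ * vline τ) - 1) / κ + vline τ =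
      (Complex.exp (-κ * vline τ) -
        ∑ k ∈ Finset.range 2, (-κ * vline τ) ^ k / (k.factorial : ℂ)) / κ := by
    simp [Finset.sum_range_succ]
    field_simp
    ring
  rw [e, norm_div, Complex.norm_real, Real.norm_of_nonneg hκ.le, div_le_iff₀ hκ]
  linarith

theorem norm_dagExponent_cubic_le {κ : ℝ} (hκ : 0 < κ) (τ : ℝ) :
    ‖-(2 / (κ : ℂ) ^ 3) * (Complex.exp (-κ * vline τ) - 1 - (-κ * vline τ) -
      (-κ * vline τ) ^ 2 / 2) - vline τ ^ 3 / 3‖ ≤ 2 * κ * ‖vline τ‖ ^ 4 := by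
  have h := norm_exp_neg_mul_vline_sub_sum_le hκ.le τ 4
  have hκ' : (κ : ℂ) ≠ 0 := Complex.ofReal_ne_zero.mpr hκ.ne'
  have e : -(2 / (κ : ℂ) ^ 3) * (Complex.exp (-κ * vline τ) - 1 - (-κ * vline τ) -
      (-κ * vline τ) ^ 2 / 2) - vline τ ^ 3 / 3 =
      -(2 / (κ : ℂ) ^ 3) * (Complex.exp (-κ * vline τ) -
        ∑ k ∈ Finset.range 4, (-κ * vline τ) ^ k / (k.factorial : ℂ)) := by
    simp [Finset.sum_range_succ, Nat.factorial]
    field_simp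
    ring
  rw [e, norm_mul, norm_neg, norm_div, norm_pow, Complex.norm_real, Real.norm_of_nonneg hκ.le,
    Complex.norm_two]
  calc 2 / κ ^ 3 * _ ≤ 2 / κ ^ 3 * (κ ^ 4 * ‖vline τ‖ ^ 4) := by gcongr
    _ = _ := by field_simp

theorem tendsto_dagIntegralDeriv (a : ℂ) :
    Tendsto (fun q : ℂ × ℝ => dagIntegralDeriv q.1 q.2) (𝓝 a ×ˢ 𝓝[>] (0 : ℝ))
      (𝓝 (-airyMoment 1 a)) := by
  have hκ : ∀ᶠ q : ℂ × ℝ in 𝓝 a ×ˢ 𝓝[>] (0 : ℝ), 0 < q.2 ∧ q.2 ≤ 1 :=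
    tendsto_snd.eventually ((eventually_mem_nhdsWithin).and
      (mem_nhdsWithin_of_mem_nhds (Iic_mem_nhds one_pos)))
  have hs : ∀ᶠ q : ℂ × ℝ in 𝓝 a ×ˢ 𝓝[>] (0 : ℝ), ‖q.1‖ ≤ ‖a‖ + 1 := by
    refine (tendsto_fst (f := 𝓝 a) (g := 𝓝[>] (0 : ℝ))).eventually
      (p := fun z : ℂ => ‖z‖ ≤ ‖a‖ + 1) ?_
    filter_upwards [Metric.ball_mem_nhds a one_pos] with z hz
    have := norm_sub_norm_le z a
    rw [Metric.mem_ball, dist_eq_norm] at hz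
    linarith
  have hsnd : Tendsto (fun q : ℂ × ℝ => q.2) (𝓝 a ×ˢ 𝓝[>] (0 : ℝ)) (𝓝 0) :=
    tendsto_snd.mono_right nhdsWithin_le_nhds
  have key := tendsto_integral_filter_of_dominated_convergence (μ := volume)
    (l := 𝓝 a ×ˢ 𝓝[>] (0 : ℝ))
    (F := fun q τ => (Complex.exp (-q.2 * vline τ) - 1) / q.2 *
      Complex.exp (dagExponent q.1 q.2 τ))
    (f := fun τ => -vline τ * airyKernel a τ)
    (fun τ => Real.exp 1 * gaussDom (‖a‖ + 1 + 1) τ)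
    (Eventually.of_forall fun q =>
      (continuous_dagIntegralDeriv_integrand q.1 q.2).aestronglyMeasurable)
    (by
      filter_upwards [hκ, hs] with q h1 h2
      exact Eventually.of_forall fun τ => norm_dagIntegralDeriv_integrand_le h2 h1.1 h1.2 τ)
    ((integrable_gaussDom _).const_mul _)
    (Eventually.of_forall fun τ => ?_)
  · have e : ∫ τ, -vline τ * airyKernel a τ = -airyMoment 1 a := by
      rw [airyMoment, ← integral_neg]
      simp only [pow_one, neg_mul]
    rw [e] at key
    exact key
  · have t1 : Tendsto (fun q : ℂ × ℝ => (Complex.exp (-q.2 * vline τ) - 1) / q.2)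
        (𝓝 a ×ˢ 𝓝[>] (0 : ℝ)) (𝓝 (-vline τ)) := by
      rw [tendsto_iff_norm_sub_tendsto_zero]
      refine squeeze_zero' (Eventually.of_forall fun _ => norm_nonneg _)
        (hκ.mono fun q hq => ?_) (by simpa using hsnd.mul_const (‖vline τ‖ ^ 2))
      rw [sub_neg_eq_add]
      exact norm_exp_sub_one_div_add_le hq.1 τ
    have t2 : Tendsto (fun q : ℂ × ℝ => -(2 / (q.2 : ℂ) ^ 3) * (Complex.exp (-q.2 * vline τ) - 1 -
        (-q.2 * vline τ) - (-q.2 * vline τ) ^ 2 / 2)) (𝓝 a ×ˢ 𝓝[>] (0 : ℝ))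
        (𝓝 (vline τ ^ 3 / 3)) := by
      rw [tendsto_iff_norm_sub_tendsto_zero]
      exact squeeze_zero' (Eventually.of_forall fun _ => norm_nonneg _)
        (hκ.mono fun q hq => norm_dagExponent_cubic_le hq.1 τ)
        (by simpa using (hsnd.const_mul 2).mul_const (‖vline τ‖ ^ 4))
    have t3 := t2.add ((tendsto_fst (f := 𝓝 a) (g := 𝓝[>] (0 : ℝ))).mul t1)
    have e : airyKernel a τ = Complex.exp (vline τ ^ 3 / 3 + a * -vline τ) := by
      rw [airyKernel]
      congr 1
      ring
    rw [e]
    exact t1.mul ((Complex.continuous_exp.tendsto _).comp t3)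

theorem conj_vline (τ : ℝ) : (starRingEnd ℂ) (vline τ) = vline (-τ) := by
  apply Complex.ext <;> simp

theorem dagIntegral_im (s κ : ℝ) : (dagIntegral (s : ℂ) κ).im = 0 := by
  have hconj : ∀ τ, (starRingEnd ℂ) (Complex.exp (dagExponent (s : ℂ) κ τ)) =
      Complex.exp (dagExponent (s : ℂ) κ (-τ)) := by
    intro τ
    rw [← Complex.exp_conj]
    congr 1
    simp only [dagExponent, map_add, map_mul, map_sub, map_neg, map_div₀, map_pow, map_ofNat,
      map_one, Complex.conj_ofReal, ← Complex.exp_conj, conj_vline]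
  rw [← Complex.conj_eq_iff_im, dagIntegral, ← integral_conj]
  simp only [hconj]
  exact integral_neg_eq_self (fun τ => Complex.exp (dagExponent (s : ℂ) κ τ)) volume

/-- The first-order coefficient in `κ` of `dagExponent (a + κ / 6) κ τ`. -/
noncomputable def dagCorrection (a : ℂ) (τ : ℝ) : ℂ :=
  -(vline τ ^ 4 / 12) + a * (vline τ ^ 2 / 2) - vline τ / 6

theorem norm_dagExponent_sub_le (a : ℂ) {κ : ℝ} (hκ : 0 < κ) (τ : ℝ) :
    ‖dagExponent (a + κ / 6) κ τ - (-a * vline τ + vline τ ^ 3 / 3) - κ * dagCorrection a τ‖ ≤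
      κ ^ 2 * ((3 + ‖a‖) * (1 + |τ|) ^ 5) := by
  have hκ' : (κ : ℂ) ≠ 0 := Complex.ofReal_ne_zero.mpr hκ.ne'
  have h2 := norm_exp_neg_mul_vline_sub_sum_le hκ.le τ 2
  have h3 := norm_exp_neg_mul_vline_sub_sum_le hκ.le τ 3
  have h5 := norm_exp_neg_mul_vline_sub_sum_le hκ.le τ 5
  have e : dagExponent (a + κ / 6) κ τ - (-a * vline τ + vline τ ^ 3 / 3) -
      κ * dagCorrection a τ =
      -(2 / (κ : ℂ) ^ 3) * (Complex.exp (-κ * vline τ) -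
        ∑ k ∈ Finset.range 5, (-κ * vline τ) ^ k / (k.factorial : ℂ)) +
      a / κ * (Complex.exp (-κ * vline τ) -
        ∑ k ∈ Finset.range 3, (-κ * vline τ) ^ k / (k.factorial : ℂ)) +
      1 / 6 * (Complex.exp (-κ * vline τ) -
        ∑ k ∈ Finset.range 2, (-κ * vline τ) ^ k / (k.factorial : ℂ)) := by
    rw [dagExponent, dagCorrection]
    generalize Complex.exp (-κ * vline τ) = E
    simp [Finset.sum_range_succ, Nat.factorial]
    field_simp
    ring
  have hX := norm_vline_le τ
  have hX1 : 1 ≤ 1 + |τ| := by linarith [abs_nonneg τ]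
  have hp : ∀ n ≤ 5, ‖vline τ‖ ^ n ≤ (1 + |τ|) ^ 5 := fun n hn =>
    (pow_le_pow_left₀ (norm_nonneg _) hX n).trans (pow_le_pow_right₀ hX1 hn)
  rw [e]
  refine (norm_add₃_le).trans ?_
  rw [norm_mul, norm_mul, norm_mul, norm_neg, norm_div, norm_div, norm_pow, Complex.norm_real,
    Real.norm_of_nonneg hκ.le, Complex.norm_two]
  have b5 : 2 / κ ^ 3 * ‖Complex.exp (-κ * vline τ) -
        ∑ k ∈ Finset.range 5, (-κ * vline τ) ^ k / (k.factorial : ℂ)‖ ≤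
      2 * κ ^ 2 * (1 + |τ|) ^ 5 := by
    calc _ ≤ 2 / κ ^ 3 * (κ ^ 5 * ‖vline τ‖ ^ 5) := by gcongr
      _ = 2 * κ ^ 2 * ‖vline τ‖ ^ 5 := by field_simp
      _ ≤ _ := by
        have := hp 5 le_rfl
        gcongr
  have b3 : ‖a‖ / κ * ‖Complex.exp (-κ * vline τ) -
        ∑ k ∈ Finset.range 3, (-κ * vline τ) ^ k / (k.factorial : ℂ)‖ ≤
      ‖a‖ * κ ^ 2 * (1 + |τ|) ^ 5 := by
    calc _ ≤ ‖a‖ / κ * (κ ^ 3 * ‖vline τ‖ ^ 3) := by gcongr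
      _ = ‖a‖ * κ ^ 2 * ‖vline τ‖ ^ 3 := by field_simp
      _ ≤ _ := by
        have := hp 3 (by norm_num)
        gcongr
  have b2 : ‖(1 / 6 : ℂ)‖ * ‖Complex.exp (-κ * vline τ) -
        ∑ k ∈ Finset.range 2, (-κ * vline τ) ^ k / (k.factorial : ℂ)‖ ≤
      κ ^ 2 * (1 + |τ|) ^ 5 := by
    calc _ ≤ 1 * (κ ^ 2 * ‖vline τ‖ ^ 2) := by
          gcongr
          norm_num
      _ = κ ^ 2 * ‖vline τ‖ ^ 2 := one_mul _
      _ ≤ _ := by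
        have := hp 2 (by norm_num)
        gcongr
  linarith

theorem norm_dagCorrection_le (a : ℂ) (τ : ℝ) :
    ‖dagCorrection a τ‖ ≤ (2 + ‖a‖) * (1 + |τ|) ^ 5 := by
  have hX := norm_vline_le τ
  have hX1 : 1 ≤ 1 + |τ| := by linarith [abs_nonneg τ]
  have hp : ∀ n ≤ 5, ‖vline τ‖ ^ n ≤ (1 + |τ|) ^ 5 := fun n hn =>
    (pow_le_pow_left₀ (norm_nonneg _) hX n).trans (pow_le_pow_right₀ hX1 hn)
  have p4 := hp 4 (by norm_num)
  have p2 := hp 2 (by norm_num)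
  have p1 := hp 1 (by norm_num)
  rw [pow_one] at p1
  rw [dagCorrection]
  refine (norm_sub_le _ _).trans ((add_le_add_left (norm_add_le _ _) _).trans ?_)
  rw [norm_neg, norm_mul, norm_div, norm_div, norm_div, norm_pow, norm_pow, Complex.norm_two]
  simp only [Complex.norm_ofNat]
  have : ‖a‖ * (‖vline τ‖ ^ 2 / 2) ≤ ‖a‖ * (1 + |τ|) ^ 5 := by
    gcongr
    linarith [sq_nonneg ‖vline τ‖]
  have := norm_nonneg (vline τ)
  have : 0 ≤ (1 + |τ|) ^ 5 := by positivity
  linarith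

theorem integrable_airyKernel (s : ℂ) : Integrable (airyKernel s) := by
  simpa using integrable_pow_mul_airyKernel 0 s

theorem integral_dagCorrection_mul_airyKernel {a : ℂ} (ha : airyMoment 0 a = 0) :
    Integrable (fun τ => dagCorrection a τ * airyKernel a τ) ∧
      ∫ τ, dagCorrection a τ * airyKernel a τ = 0 := by
  have i4 := (integrable_pow_mul_airyKernel 4 a).const_mul (-1 / 12)
  have i2 := (integrable_pow_mul_airyKernel 2 a).const_mul (a / 2)
  have i1 := (integrable_pow_mul_airyKernel 1 a).const_mul (1 / 6)
  have e : (fun τ => dagCorrection a τ * airyKernel a τ) = fun τ =>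
      -1 / 12 * (vline τ ^ 4 * airyKernel a τ) + a / 2 * (vline τ ^ 2 * airyKernel a τ) -
        1 / 6 * (vline τ ^ 1 * airyKernel a τ) := by
    ext τ
    rw [dagCorrection]
    ring
  have i42 : Integrable fun τ => -1 / 12 * (vline τ ^ 4 * airyKernel a τ) +
      a / 2 * (vline τ ^ 2 * airyKernel a τ) := i4.add i2
  rw [e]
  refine ⟨i42.sub i1, ?_⟩
  rw [integral_sub i42 i1, integral_add i4 i2, integral_const_mul, integral_const_mul,
    integral_const_mul]
  change -1 / 12 * airyMoment 4 a + a / 2 * airyMoment 2 a - 1 / 6 * airyMoment 1 a = 0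
  have m2 := airyMoment_add_two 0 a
  have m4 := airyMoment_add_two 2 a
  norm_num [ha] at m2 m4
  rw [m4, m2]
  ring

theorem exists_norm_dagIntegral_le {a : ℂ} (ha : airyMoment 0 a = 0) :
    ∃ M, ∀ κ : ℝ, 0 < κ → κ ≤ 1 → ‖dagIntegral (a + κ / 6) κ‖ ≤ M * κ ^ 2 := by
  set L : ℝ := 5 + 2 * ‖a‖ with hL
  have hL1 : 1 ≤ L := by linarith [norm_nonneg a]
  set K : ℝ := 3 * L ^ 2 * Real.exp 1 * (Nat.factorial 10 : ℝ) with hK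
  refine ⟨∫ τ, K * gaussDom (‖a‖ + 1 + 1) τ, fun κ hκ hκ1 => ?_⟩
  obtain ⟨hCi, hC0⟩ := integral_dagCorrection_mul_airyKernel ha
  have hAi := integrable_exp_dagExponent (a + κ / 6) hκ hκ1
  have hBi := integrable_airyKernel a
  have hB0 : ∫ τ, airyKernel a τ = 0 := by
    rw [← ha, airyMoment]
    simp only [pow_zero, one_mul]
  have hABi : Integrable fun τ => Complex.exp (dagExponent (a + κ / 6) κ τ) - airyKernel a τ :=
    hAi.sub hBi
  have hsplit : dagIntegral (a + κ / 6) κ = ∫ τ, (Complex.exp (dagExponent (a + κ / 6) κ τ) -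
      airyKernel a τ - κ * (dagCorrection a τ * airyKernel a τ)) := by
    rw [integral_sub hABi (hCi.const_mul _), integral_sub hAi hBi,
      integral_const_mul, hC0, hB0, dagIntegral]
    ring
  rw [hsplit, ← integral_mul_const]
  refine norm_integral_le_of_norm_le (((integrable_gaussDom _).const_mul K).mul_const _)
    (Eventually.of_forall fun τ => ?_)
  set A := dagExponent (a + κ / 6) κ τ with hA
  set B := -a * vline τ + vline τ ^ 3 / 3 with hB
  set C := dagCorrection a τ with hC
  have hkB : airyKernel a τ = Complex.exp B := rfl
  set X : ℝ := 1 + |τ| with hX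
  have hX1 : 1 ≤ X := by linarith [abs_nonneg τ]
  set g := gaussDom (‖a‖ + 1) τ with hg
  have hg0 : 0 < g := gaussDom_pos _ _
  have hD : ‖A - B - κ * C‖ ≤ κ ^ 2 * ((3 + ‖a‖) * X ^ 5) := norm_dagExponent_sub_le a hκ τ
  have hCn : ‖C‖ ≤ (2 + ‖a‖) * X ^ 5 := norm_dagCorrection_le a τ
  have hAB : ‖A - B‖ ≤ κ * (L * X ^ 5) := by
    have h1 : ‖A - B‖ ≤ ‖A - B - κ * C‖ + ‖(κ : ℂ) * C‖ := by
      simpa using norm_add_le (A - B - κ * C) (κ * C)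
    rw [norm_mul, Complex.norm_real, Real.norm_of_nonneg hκ.le] at h1
    have h2 : κ ^ 2 * ((3 + ‖a‖) * X ^ 5) ≤ κ * ((3 + ‖a‖) * X ^ 5) := by
      gcongr
      nlinarith
    have h3 : κ * ‖C‖ ≤ κ * ((2 + ‖a‖) * X ^ 5) := by gcongr
    calc ‖A - B‖ ≤ κ * ((3 + ‖a‖) * X ^ 5) + κ * ((2 + ‖a‖) * X ^ 5) := by linarith
      _ = _ := by rw [hL]; ring
  have hs : ‖a + (κ : ℂ) / 6‖ ≤ ‖a‖ + 1 := by
    refine (norm_add_le _ _).trans ?_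
    rw [norm_div, Complex.norm_real, Real.norm_of_nonneg hκ.le, Complex.norm_ofNat]
    linarith
  have hEA : ‖Complex.exp A‖ ≤ Real.exp 1 * g := norm_exp_dagExponent_le hs hκ hκ1 τ
  have hEB : ‖Complex.exp B‖ ≤ Real.exp 1 * g :=
    norm_airyKernel_le (by linarith : ‖a‖ ≤ ‖a‖ + 1) τ
  have hid : Complex.exp A - airyKernel a τ - κ * (C * airyKernel a τ) =
      Complex.exp B * (Complex.exp (A - B) - 1 - (A - B)) + Complex.exp B * (A - B - κ * C) := by
    have : Complex.exp A = Complex.exp B * Complex.exp (A - B) := by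
      rw [← Complex.exp_add]
      congr 1
      ring
    rw [hkB, this]
    ring
  have hT1 : ‖Complex.exp B * (Complex.exp (A - B) - 1 - (A - B))‖ ≤
      (κ * (L * X ^ 5)) ^ 2 * (2 * (Real.exp 1 * g)) := by
    rw [norm_mul]
    calc _ ≤ ‖Complex.exp B‖ * (‖A - B‖ ^ 2 * (1 + ‖Complex.exp (A - B)‖)) := by
          gcongr
          exact norm_exp_sub_one_sub_self_le _
      _ = ‖A - B‖ ^ 2 * (‖Complex.exp B‖ + ‖Complex.exp B * Complex.exp (A - B)‖) := by
          rw [norm_mul]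
          ring
      _ = ‖A - B‖ ^ 2 * (‖Complex.exp B‖ + ‖Complex.exp A‖) := by
          rw [← Complex.exp_add]
          congr 4
          ring
      _ ≤ _ := by
          gcongr
          linarith
  have hT2 : ‖Complex.exp B * (A - B - κ * C)‖ ≤
      (Real.exp 1 * g) * (κ ^ 2 * (L ^ 2 * X ^ 10)) := by
    rw [norm_mul]
    have h1 : (3 + ‖a‖) * X ^ 5 ≤ L ^ 2 * X ^ 10 := by
      gcongr
      · nlinarith [norm_nonneg a]
      · norm_num
    have h2 : ‖A - B - κ * C‖ ≤ κ ^ 2 * (L ^ 2 * X ^ 10) := hD.trans (by gcongr)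
    gcongr
  have hpow : X ^ 10 * g ≤ (Nat.factorial 10 : ℝ) * gaussDom (‖a‖ + 1 + 1) τ :=
    pow_mul_gaussDom_le 10 _ τ
  rw [hid]
  calc _ ≤ (κ * (L * X ^ 5)) ^ 2 * (2 * (Real.exp 1 * g)) +
        (Real.exp 1 * g) * (κ ^ 2 * (L ^ 2 * X ^ 10)) :=
          (norm_add_le _ _).trans (add_le_add hT1 hT2)
    _ = κ ^ 2 * (3 * L ^ 2 * Real.exp 1) * (X ^ 10 * g) := by ring
    _ ≤ κ ^ 2 * (3 * L ^ 2 * Real.exp 1) *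
        ((Nat.factorial 10 : ℝ) * gaussDom (‖a‖ + 1 + 1) τ) := by gcongr
    _ = K * gaussDom (‖a‖ + 1 + 1) τ * κ ^ 2 := by
        rw [hK]
        ring

/-- A function whose derivative is at least `m` near a point where it is at most `m * r` in
absolute value has a zero within distance `r`. -/
theorem exists_zero_of_le_deriv {h h' : ℝ → ℝ} {x₀ r m : ℝ} (hr : 0 ≤ r)
    (hd : ∀ x ∈ Set.Icc (x₀ - r) (x₀ + r), HasDerivAt h (h' x) x)
    (hm : ∀ x ∈ Set.Icc (x₀ - r) (x₀ + r), m ≤ h' x) (h₀ : |h x₀| ≤ m * r) :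
    ∃ x ∈ Set.Icc (x₀ - r) (x₀ + r), h x = 0 := by
  have hcont : ContinuousOn h (Set.Icc (x₀ - r) (x₀ + r)) := fun x hx =>
    (hd x hx).continuousAt.continuousWithinAt
  have hmv := Convex.mul_sub_le_image_sub_of_le_deriv (convex_Icc (x₀ - r) (x₀ + r)) hcont
    (fun x hx => (hd x (interior_subset hx)).differentiableAt.differentiableWithinAt)
    (C := m) (fun x hx => by
      rw [(hd x (interior_subset hx)).deriv]
      exact hm x (interior_subset hx))
  have hl : x₀ - r ∈ Set.Icc (x₀ - r) (x₀ + r) := ⟨le_rfl, by linarith⟩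
  have hc : x₀ ∈ Set.Icc (x₀ - r) (x₀ + r) := ⟨by linarith, by linarith⟩
  have hu : x₀ + r ∈ Set.Icc (x₀ - r) (x₀ + r) := ⟨by linarith, le_rfl⟩
  have h1 := hmv _ hl _ hc (by linarith)
  have h2 := hmv _ hc _ hu (by linarith)
  rw [abs_le] at h₀
  exact intermediate_value_Icc (by linarith) hcont ⟨by linarith, by linarith⟩

theorem airyMoment_im (n : ℕ) (s : ℝ) : (airyMoment n (s : ℂ)).im = 0 := by
  have hconj : ∀ τ, (starRingEnd ℂ) (vline τ ^ n * airyKernel (s : ℂ) τ) =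
      vline (-τ) ^ n * airyKernel (s : ℂ) (-τ) := by
    intro τ
    simp only [airyKernel, map_add, map_mul, map_neg, map_div₀, map_pow, map_ofNat,
      Complex.conj_ofReal, ← Complex.exp_conj, conj_vline]
  rw [← Complex.conj_eq_iff_im, airyMoment, ← integral_conj]
  simp only [hconj]
  exact integral_neg_eq_self (fun τ => vline τ ^ n * airyKernel (s : ℂ) τ) volume

theorem exists_dagIntegral_eq_zero {a : ℝ} (ha : airyMoment 0 (a : ℂ) = 0) :
    ∃ κ₁ > (0 : ℝ), κ₁ ≤ 1 ∧ ∃ K, ∀ κ : ℝ, 0 < κ → κ < κ₁ →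
      ∃ s : ℝ, dagIntegral (s : ℂ) κ = 0 ∧ |s - (a + κ / 6)| ≤ K * κ ^ 2 := by
  obtain ⟨M₀, hM₀⟩ := exists_norm_dagIntegral_le ha
  set M := |M₀| with hM
  set c : ℝ := -(airyMoment 1 (a : ℂ)).re with hc
  have hc0 : c ≠ 0 := by
    intro h
    refine airyMoment_one_ne_zero ha (Complex.ext ?_ (airyMoment_im 1 a))
    rw [Complex.zero_re]
    linarith
  have hcpos : 0 < |c| := abs_pos.mpr hc0
  have hc2 : 0 < c ^ 2 := by positivity
  have hlim : Tendsto (fun q : ℂ × ℝ => c * (dagIntegralDeriv q.1 q.2).re)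
      (𝓝 (a : ℂ) ×ˢ 𝓝[>] (0 : ℝ)) (𝓝 (c * c)) :=
    ((Complex.continuous_re.tendsto _).comp (tendsto_dagIntegralDeriv (a : ℂ))).const_mul c
  have hev := hlim.eventually (lt_mem_nhds (show c ^ 2 / 2 < c * c by nlinarith))
  obtain ⟨P, hP, Q, hQ, hPQ⟩ := eventually_prod_iff.mp hev
  obtain ⟨ε, hε, hPε⟩ := Metric.eventually_nhds_iff.mp hP
  obtain ⟨δ, hδ, hQδ⟩ := mem_nhdsGT_iff_exists_Ioo_subset.mp hQ
  have hδ0 : (0 : ℝ) < δ := hδ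
  set K : ℝ := 2 * M / |c| with hK
  have hK0 : 0 ≤ K := by positivity
  refine ⟨min (min δ 1) (ε / (1 + K)), by positivity, (min_le_left _ _).trans (min_le_right _ _),
    K, fun κ hκ hκ₁ => ?_⟩
  have hκδ : κ < δ := hκ₁.trans_le ((min_le_left _ _).trans (min_le_left _ _))
  have hκ1 : κ ≤ 1 := (hκ₁.trans_le ((min_le_left _ _).trans (min_le_right _ _))).le
  have hκε : κ * (1 + K) < ε := by
    rw [← lt_div_iff₀ (by positivity)]
    exact hκ₁.trans_le (min_le_right _ _)
  have hclose : κ / 6 + K * κ ^ 2 < ε := by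
    have : K * κ ^ 2 ≤ K * κ := by
      gcongr
      nlinarith
    nlinarith
  have hd : ∀ x : ℝ, HasDerivAt (fun x : ℝ => c * (dagIntegral (x : ℂ) κ).re)
      (c * (dagIntegralDeriv (x : ℂ) κ).re) x := fun x =>
    (hasDerivAt_dagIntegral (x : ℂ) hκ hκ1).real_of_complex.const_mul c
  obtain ⟨s, hs, hs0⟩ := exists_zero_of_le_deriv (h := fun x : ℝ => c * (dagIntegral (x : ℂ) κ).re)
    (x₀ := a + κ / 6) (r := K * κ ^ 2) (m := c ^ 2 / 2) (by positivity) (fun x _ => hd x)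
    (fun x hx => by
      have hx' : dist (x : ℂ) (a : ℂ) < ε := by
        rw [dist_eq_norm, ← Complex.ofReal_sub, Complex.norm_real, Real.norm_eq_abs, abs_lt]
        constructor <;> linarith [hx.1, hx.2]
      exact (hPQ (hPε hx') (hQδ ⟨hκ, hκδ⟩)).le)
    (by
      have h1 := hM₀ κ hκ hκ1
      have h2 : |(dagIntegral ((a + κ / 6 : ℝ) : ℂ) κ).re| ≤ M * κ ^ 2 := by
        refine (Complex.abs_re_le_norm _).trans ?_
        push_cast
        exact h1.trans (by
          have := le_abs_self M₀
          gcongr)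
      rw [abs_mul]
      calc |c| * |(dagIntegral ((a + κ / 6 : ℝ) : ℂ) κ).re| ≤ |c| * (M * κ ^ 2) := by gcongr
        _ = c ^ 2 / 2 * (K * κ ^ 2) := by
          rw [hK, ← sq_abs c]
          field_simp)
  refine ⟨s, ?_, ?_⟩
  · refine Complex.ext ?_ ?_
    · exact (mul_eq_zero.mp hs0).resolve_left hc0
    · exact dagIntegral_im s κ
  · rw [abs_le]
    constructor <;> linarith [hs.1, hs.2]

/-- Shift of the contour of the deformed exponential to a parallel line. -/
theorem integral_deformed_exp_shift {A : ℝ} (hA : 0 < A) (Z : ℂ) {b : ℝ} (hb0 : 0 ≤ b)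
    (hb1 : b ≤ 1) :
    ∫ x : ℝ, Complex.exp (-(x : ℂ) ^ 2 / A - Z * Complex.exp (-Complex.I * x)) =
      ∫ x : ℝ, Complex.exp (-((x : ℂ) + b * Complex.I) ^ 2 / A -
        Z * Complex.exp (-Complex.I * ((x : ℂ) + b * Complex.I))) := by
  set F : ℂ → ℂ := fun x => Complex.exp (-x ^ 2 / A - Z * Complex.exp (-Complex.I * x)) with hFdef
  have hF : Differentiable ℂ F := by
    rw [hFdef]
    fun_prop
  set K : ℝ := Real.exp (1 / A + ‖Z‖ * Real.exp 1) with hK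
  have hbound : ∀ (z : ℂ), 0 ≤ z.im → z.im ≤ 1 →
      ‖F z‖ ≤ K * Real.exp (-(1 / A) * z.re ^ 2) := by
    intro z h0 h1
    rw [hFdef, Complex.norm_exp, hK, ← Real.exp_add]
    refine Real.exp_le_exp.mpr ?_
    have hsq : (-z ^ 2 / (A : ℂ)).re = (z.im ^ 2 - z.re ^ 2) / A := by
      rw [Complex.div_ofReal_re, Complex.neg_re, pow_two, Complex.mul_re]
      ring
    have hexp : -(Z * Complex.exp (-Complex.I * z)).re ≤ ‖Z‖ * Real.exp 1 := by
      refine (neg_le_abs _).trans ((Complex.abs_re_le_norm _).trans ?_)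
      rw [norm_mul, Complex.norm_exp]
      gcongr
      simpa using h1
    rw [Complex.sub_re, hsq]
    have : (z.im ^ 2 - z.re ^ 2) / A ≤ 1 / A + -(1 / A) * z.re ^ 2 := by
      rw [show 1 / A + -(1 / A) * z.re ^ 2 = (1 - z.re ^ 2) / A by ring]
      gcongr
      nlinarith
    linarith
  have hid : ∀ x : ℝ, HasDerivAt (fun y : ℝ => (y : ℂ)) 1 x := fun x =>
    Complex.ofRealCLM.hasDerivAt
  have hB : ∀ x : ℝ, ∀ z ∈ segment ℝ (x : ℂ) ((x : ℂ) + b * Complex.I),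
      ‖F z‖ ≤ K * Real.exp (-(1 / A) * x ^ 2) := by
    intro x z hz
    obtain ⟨p, q, hp, hq, hpq, rfl⟩ := hz
    have hre : (p • (x : ℂ) + q • ((x : ℂ) + b * Complex.I)).re = x := by
      simp only [Complex.add_re, Complex.smul_re, Complex.ofReal_re, Complex.mul_re, Complex.I_re,
        Complex.ofReal_im, Complex.I_im, smul_eq_mul]
      linear_combination x * hpq
    have him : (p • (x : ℂ) + q • ((x : ℂ) + b * Complex.I)).im = q * b := by
      simp
    have := hbound (p • (x : ℂ) + q • ((x : ℂ) + b * Complex.I))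
      (by rw [him]; positivity) (by rw [him]; nlinarith)
    rwa [hre] at this
  have hdom : Integrable fun x : ℝ => K * Real.exp (-(1 / A) * x ^ 2) :=
    (integrable_exp_neg_mul_sq (by positivity)).const_mul K
  have hi₁ : Integrable fun x : ℝ => F x * 1 :=
    (hdom.mono' (hF.continuous.comp Complex.continuous_ofReal).aestronglyMeasurable
      (Eventually.of_forall fun x => hB x _ (left_mem_segment ℝ _ _))).mul_const _
  have hi₂ : Integrable fun x : ℝ => F ((x : ℂ) + b * Complex.I) * 1 :=
    (hdom.mono' (hF.continuous.comp (by fun_prop)).aestronglyMeasurable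
      (Eventually.of_forall fun x => hB x _ (right_mem_segment ℝ _ _))).mul_const _
  have hlim : ∀ l : Filter ℝ, Tendsto (fun τ : ℝ => |τ|) l atTop →
      Tendsto (fun x : ℝ => K * Real.exp (-(1 / A) * x ^ 2) *
        ‖(x : ℂ) + b * Complex.I - x‖) l (𝓝 0) := by
    intro l hl
    have h : Tendsto (fun τ : ℝ => |τ| ^ 2) l atTop := (tendsto_pow_atTop two_ne_zero).comp hl
    simp only [sq_abs] at h
    have hneg : -(1 / A) < 0 := by
      rw [neg_lt_zero]
      positivity
    have := ((Real.tendsto_exp_atBot.comp (h.const_mul_atTop_of_neg hneg)).const_mul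
      K).mul_const ‖(b : ℂ) * Complex.I‖
    simpa using this
  have := integral_comp_path_eq hF (N := ∅) (γ₁ := fun x : ℝ => (x : ℂ))
    (γ₂ := fun x : ℝ => (x : ℂ) + b * Complex.I) (γ₁' := fun _ => 1) (γ₂' := fun _ => 1)
    Set.countable_empty Complex.continuous_ofReal (by fun_prop) (fun x _ => hid x)
    (fun x _ => (hid x).add_const _) hi₁ hi₂ hB (hlim _ tendsto_abs_atTop_atTop)
    (hlim _ tendsto_abs_atBot_atTop)
  simpa only [mul_one] using this

theorem phiTilde_eq_dagIntegral {w κ : ℝ} (hκ : 0 < κ) (hκ1 : κ ≤ 1)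
    (hw : Real.log (1 + w) = κ ^ 3 / 2) {s z : ℂ}
    (hz : z * (√(1 + w) : ℂ) * Complex.exp 1 = (1 - s * κ ^ 2 / 2) * (2 / κ ^ 3)) :
    phiTilde z w = κ / (√(Real.pi * κ ^ 3) : ℂ) *
      Complex.exp (-1 / (κ : ℂ) ^ 3 + s / κ) * dagIntegral s κ := by
  have hκ' : (κ : ℂ) ≠ 0 := Complex.ofReal_ne_zero.mpr hκ.ne'
  have hsqrt : 2 * Real.pi * Real.log (1 + w) = Real.pi * κ ^ 3 := by rw [hw]; ring
  have hden : 2 * (Real.log (1 + w) : ℂ) = ((κ ^ 3 : ℝ) : ℂ) := by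
    rw [hw]
    push_cast
    ring
  set Z := z * (√(1 + w) : ℂ) with hZ
  have hshift := integral_deformed_exp_shift (A := κ ^ 3) (by positivity) Z
    (b := 1 - κ / 2) (by linarith) (by linarith)
  have hscale := Measure.integral_comp_mul_left (fun x : ℝ =>
    Complex.exp (-((x : ℂ) + (1 - κ / 2 : ℝ) * Complex.I) ^ 2 / ((κ ^ 3 : ℝ) : ℂ) -
        Z * Complex.exp (-Complex.I * ((x : ℂ) + (1 - κ / 2 : ℝ) * Complex.I)))) κ
  rw [abs_of_pos (inv_pos.mpr hκ), Complex.real_smul, Complex.ofReal_inv] at hscale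
  have hpt : ∀ τ : ℝ, Complex.exp (-(((κ * τ : ℝ) : ℂ) + (1 - κ / 2 : ℝ) * Complex.I) ^ 2 /
      ((κ ^ 3 : ℝ) : ℂ) - Z * Complex.exp (-Complex.I * (((κ * τ : ℝ) : ℂ) +
        (1 - κ / 2 : ℝ) * Complex.I))) =
      Complex.exp (-1 / (κ : ℂ) ^ 3 + s / κ) * Complex.exp (dagExponent s κ τ) := by
    intro τ
    rw [← Complex.exp_add]
    congr 1
    have hI : Complex.I ^ 2 = -1 := Complex.I_sq
    have harg : -Complex.I * (((κ * τ : ℝ) : ℂ) + (1 - κ / 2 : ℝ) * Complex.I) =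
        1 + -κ * vline τ := by
      rw [vline]
      push_cast
      linear_combination (-(1 - (κ : ℂ) / 2)) * hI
    have hsq : -(((κ * τ : ℝ) : ℂ) + (1 - κ / 2 : ℝ) * Complex.I) ^ 2 =
        (1 + -κ * vline τ) ^ 2 := by
      rw [← harg]
      linear_combination (-(((κ * τ : ℝ) : ℂ) + (1 - κ / 2 : ℝ) * Complex.I) ^ 2) * hI
    rw [harg, hsq, Complex.exp_add, ← mul_assoc, hz, dagExponent]
    generalize Complex.exp (-κ * vline τ) = E
    push_cast
    field_simp
    ring
  simp only [hpt] at hscale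
  rw [integral_const_mul] at hscale
  rw [phiTilde, hsqrt, hden, hshift]
  rw [dagIntegral]
  rw [eq_inv_mul_iff_mul_eq₀ hκ'] at hscale
  rw [← hscale]
  ring

theorem deriv_phiTilde_eq {w κ : ℝ} (hκ : 0 < κ) (hκ1 : κ ≤ 1)
    (hw : Real.log (1 + w) = κ ^ 3 / 2) {s z : ℂ}
    (hz : z * (√(1 + w) : ℂ) * Complex.exp 1 = (1 - s * κ ^ 2 / 2) * (2 / κ ^ 3))
    (hs : dagIntegral s κ = 0) :
    deriv (fun ζ => phiTilde ζ w) z = -(κ ^ 2 / (√(Real.pi * κ ^ 3) : ℂ) * (√(1 + w) : ℂ) *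
      Complex.exp (1 - 1 / (κ : ℂ) ^ 3 + s / κ) * dagIntegralDeriv s κ) := by
  have hκ' : (κ : ℂ) ≠ 0 := Complex.ofReal_ne_zero.mpr hκ.ne'
  set σ : ℂ → ℂ := fun ζ => 2 / (κ : ℂ) ^ 2 -
    ζ * ((√(1 + w) : ℂ) * Complex.exp 1 * κ) with hσ
  have hσz : σ z = s := by
    have h := congrArg (fun y : ℂ => y * κ) hz
    rw [hσ]
    simp only
    rw [← mul_assoc, ← mul_assoc, h]
    field_simp
    ring
  have hfun : (fun ζ => phiTilde ζ w) = fun ζ => κ / (√(Real.pi * κ ^ 3) : ℂ) *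
      Complex.exp (-1 / (κ : ℂ) ^ 3 + σ ζ / κ) * dagIntegral (σ ζ) κ := by
    ext ζ
    refine phiTilde_eq_dagIntegral hκ hκ1 hw ?_
    rw [hσ]
    field_simp
    ring
  have hσd : HasDerivAt σ (-(1 * ((√(1 + w) : ℂ) * Complex.exp 1 * κ))) z :=
    ((hasDerivAt_id z).mul_const _).const_sub _
  have hI : HasDerivAt (fun ζ => dagIntegral (σ ζ) κ)
      (dagIntegralDeriv s κ * -(1 * ((√(1 + w) : ℂ) * Complex.exp 1 * κ))) z := by
    have h := hasDerivAt_dagIntegral (σ z) hκ hκ1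
    rw [hσz] at h
    exact HasDerivAt.comp_of_eq z h hσd hσz.symm
  have hE := (((hσd.div_const (κ : ℂ)).const_add (-1 / (κ : ℂ) ^ 3)).cexp).const_mul
    (κ / (√(Real.pi * κ ^ 3) : ℂ))
  rw [hfun, (hE.fun_mul hI).deriv, hσz, hs,
    show 1 - 1 / (κ : ℂ) ^ 3 + s / κ = 1 + (-1 / (κ : ℂ) ^ 3 + s / κ) by ring,
    Complex.exp_add 1]
  ring

theorem log_one_add_mul_sqrt_le {w : ℝ} (hw : 0 < w) : Real.log (1 + w) * √(1 + w) ≤ w := by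
  have h1 : 0 < √(1 + w) := Real.sqrt_pos.mpr (by linarith)
  have hsq : √(1 + w) ^ 2 = 1 + w := Real.sq_sqrt (by linarith)
  have hx : 0 ≤ Real.log √(1 + w) :=
    Real.log_nonneg (Real.one_le_sqrt.mpr (by linarith))
  have h := Real.self_le_sinh_iff.mpr hx
  rw [Real.sinh_eq, Real.exp_neg, Real.exp_log h1] at h
  rw [← hsq, Real.log_pow, hsq]
  have h2 := mul_le_mul_of_nonneg_right h h1.le
  have h3 : (√(1 + w) - (√(1 + w))⁻¹) / 2 * √(1 + w) = w / 2 := by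
    field_simp
    linarith
  push_cast
  nlinarith

theorem log_one_add_bounds {w : ℝ} (hw : 0 < w) :
    0 < Real.log (1 + w) ∧ Real.log (1 + w) ≤ w ∧ 2 * w / (w + 2) ≤ Real.log (1 + w) := by
  refine ⟨Real.log_pos (by linarith), ?_, Real.le_log_one_add_of_nonneg hw.le⟩
  linarith [Real.log_le_sub_one_of_pos (show 0 < 1 + w by linarith)]

theorem tendsto_inv_log_one_add_sub_inv :
    Tendsto (fun w : ℝ => 1 / Real.log (1 + w) - 1 / w) (𝓝[>] 0) (𝓝 (1 / 2)) := by
  have hlow : Tendsto (fun w : ℝ => 1 / (√(1 + w) + 1)) (𝓝[>] 0) (𝓝 (1 / 2)) := by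
    have h : ContinuousAt (fun w : ℝ => 1 / (√(1 + w) + 1)) 0 := by
      refine ContinuousAt.div (by fun_prop) (by fun_prop) (by positivity)
    have := h.tendsto.mono_left (nhdsWithin_le_nhds (s := Set.Ioi 0))
    norm_num at this ⊢
    exact this
  refine tendsto_of_tendsto_of_tendsto_of_le_of_le' hlow tendsto_const_nhds ?_ ?_
  · filter_upwards [self_mem_nhdsWithin] with w (hw : 0 < w)
    obtain ⟨hα, -, -⟩ := log_one_add_bounds hw
    have hsq : √(1 + w) ^ 2 = 1 + w := Real.sq_sqrt (by linarith)
    have h : √(1 + w) / w ≤ 1 / Real.log (1 + w) := by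
      rw [div_le_div_iff₀ hw hα]
      linarith [log_one_add_mul_sqrt_le hw]
    have h2 : 1 / (√(1 + w) + 1) = √(1 + w) / w - 1 / w := by
      have : √(1 + w) + 1 ≠ 0 := by positivity
      field_simp
      linarith
    linarith
  · filter_upwards [self_mem_nhdsWithin] with w (hw : 0 < w)
    obtain ⟨hα, -, h⟩ := log_one_add_bounds hw
    have h1 : 1 / Real.log (1 + w) ≤ 1 / (2 * w / (w + 2)) :=
      one_div_le_one_div_of_le (by positivity) h
    have h2 : 1 / (2 * w / (w + 2)) = 1 / 2 + 1 / w := by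
      field_simp
    linarith

theorem div_log_one_add_mul_sqrt_bounds {w : ℝ} (hw : 0 < w) :
    1 ≤ w / (Real.log (1 + w) * √(1 + w)) ∧
      w / (Real.log (1 + w) * √(1 + w)) ≤ 1 + w ^ 2 := by
  obtain ⟨hα, -, h⟩ := log_one_add_bounds hw
  have h1 : 0 < √(1 + w) := Real.sqrt_pos.mpr (by linarith)
  have hsq : √(1 + w) ^ 2 = 1 + w := Real.sq_sqrt (by linarith)
  refine ⟨(one_le_div (by positivity)).mpr (log_one_add_mul_sqrt_le hw), ?_⟩
  rw [div_le_iff₀ (by positivity)]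
  have h2 : 1 + w / 2 ≤ (1 + w ^ 2) * √(1 + w) := by
    refine (sq_le_sq₀ (by positivity) (by positivity)).mp ?_
    rw [mul_pow, hsq]
    nlinarith [pow_pos hw 2, pow_pos hw 3, pow_pos hw 4, pow_pos hw 5]
  rw [div_le_iff₀ (by positivity)] at h
  have h3 := mul_le_mul_of_nonneg_left h2 hα.le
  nlinarith

/-- The scaling parameter `κ` with `κ ^ 3 = 2 log (1 + w)`. -/
noncomputable def dagScale (w : ℝ) : ℝ := (2 * Real.log (1 + w)) ^ ((1 : ℝ) / 3)

theorem rpow_third_pow_three {x : ℝ} (hx : 0 ≤ x) : (x ^ ((1 : ℝ) / 3)) ^ 3 = x := by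
  rw [← Real.rpow_natCast, ← Real.rpow_mul hx]
  norm_num

theorem dagScale_pos {w : ℝ} (hw : 0 < w) : 0 < dagScale w :=
  Real.rpow_pos_of_pos (by linarith [(log_one_add_bounds hw).1]) _

theorem dagScale_pow_three {w : ℝ} (hw : 0 < w) :
    dagScale w ^ 3 = 2 * Real.log (1 + w) :=
  rpow_third_pow_three (by linarith [(log_one_add_bounds hw).1])

theorem dagScale_le {w : ℝ} (hw : 0 < w) : dagScale w ≤ (2 * w) ^ ((1 : ℝ) / 3) := by
  obtain ⟨h0, h1, -⟩ := log_one_add_bounds hw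
  exact Real.rpow_le_rpow (by linarith) (by linarith) (by norm_num)

theorem tendsto_rpow_third_two_mul :
    Tendsto (fun w : ℝ => (2 * w) ^ ((1 : ℝ) / 3)) (𝓝[>] 0) (𝓝 0) := by
  have h : ContinuousAt (fun w : ℝ => (2 * w) ^ ((1 : ℝ) / 3)) 0 :=
    ContinuousAt.rpow_const (by fun_prop) (Or.inr (by norm_num))
  have := h.tendsto.mono_left (nhdsWithin_le_nhds (s := Set.Ioi 0))
  simpa using this

theorem tendsto_dagScale : Tendsto dagScale (𝓝[>] 0) (𝓝[>] 0) := by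
  refine tendsto_nhdsWithin_iff.mpr ⟨?_, ?_⟩
  · refine tendsto_of_tendsto_of_tendsto_of_le_of_le' tendsto_const_nhds
      tendsto_rpow_third_two_mul ?_ ?_
    · filter_upwards [self_mem_nhdsWithin] with w hw using (dagScale_pos hw).le
    · filter_upwards [self_mem_nhdsWithin] with w hw using dagScale_le hw
  · filter_upwards [self_mem_nhdsWithin] with w hw using dagScale_pos hw

theorem tendsto_dagScale_div :
    Tendsto (fun w : ℝ => dagScale w / (2 * w) ^ ((1 : ℝ) / 3)) (𝓝[>] 0) (𝓝 1) := by
  have hlow : Tendsto (fun w : ℝ => 2 / (w + 2)) (𝓝[>] 0) (𝓝 1) := by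
    have h : ContinuousAt (fun w : ℝ => 2 / (w + 2)) 0 :=
      ContinuousAt.div (by fun_prop) (by fun_prop) (by norm_num)
    have := h.tendsto.mono_left (nhdsWithin_le_nhds (s := Set.Ioi 0))
    simpa using this
  refine tendsto_of_tendsto_of_tendsto_of_le_of_le' hlow tendsto_const_nhds ?_ ?_
  · filter_upwards [self_mem_nhdsWithin] with w (hw : 0 < w)
    have hX : 0 < (2 * w) ^ ((1 : ℝ) / 3) := Real.rpow_pos_of_pos (by linarith) _
    have h1 := (div_le_one hX).mpr (dagScale_le hw)
    have h0 : 0 ≤ dagScale w / (2 * w) ^ ((1 : ℝ) / 3) := div_nonneg (dagScale_pos hw).le hX.le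
    refine le_trans ?_ (pow_le_of_le_one h0 h1 three_ne_zero)
    rw [div_pow, dagScale_pow_three hw, rpow_third_pow_three (by linarith)]
    have := (log_one_add_bounds hw).2.2
    rw [mul_div_mul_left _ _ two_ne_zero, le_div_iff₀ hw]
    rwa [div_mul_eq_mul_div]
  · filter_upwards [self_mem_nhdsWithin] with w (hw : 0 < w)
    exact (div_le_one (Real.rpow_pos_of_pos (by linarith) _)).mpr (dagScale_le hw)

theorem tendsto_inv_dagScale_pow_three_sub :
    Tendsto (fun w : ℝ => 1 / dagScale w ^ 3 - 1 / (2 * w)) (𝓝[>] 0) (𝓝 (1 / 4)) := by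
  have h := tendsto_inv_log_one_add_sub_inv.const_mul (1 / 2)
  norm_num at h ⊢
  refine h.congr' ?_
  filter_upwards [self_mem_nhdsWithin] with w (hw : 0 < w)
  rw [dagScale_pow_three hw, mul_inv]
  ring

theorem tendsto_inv_dagScale_sub :
    Tendsto (fun w : ℝ => 1 / dagScale w - 1 / (2 * w) ^ ((1 : ℝ) / 3)) (𝓝[>] 0) (𝓝 0) := by
  have hκ : Tendsto dagScale (𝓝[>] 0) (𝓝 0) := tendsto_dagScale.mono_right nhdsWithin_le_nhds
  have hup := tendsto_inv_dagScale_pow_three_sub.mul (hκ.pow 2)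
  norm_num only [mul_zero] at hup
  refine tendsto_of_tendsto_of_tendsto_of_le_of_le' tendsto_const_nhds hup ?_ ?_
  · filter_upwards [self_mem_nhdsWithin] with w (hw : 0 < w)
    exact sub_nonneg.mpr (one_div_le_one_div_of_le (dagScale_pos hw) (dagScale_le hw))
  · filter_upwards [self_mem_nhdsWithin] with w (hw : 0 < w)
    have hκ0 := dagScale_pos hw
    have hX : 0 < (2 * w) ^ ((1 : ℝ) / 3) := Real.rpow_pos_of_pos (by linarith) _
    have h := one_div_le_one_div_of_le hκ0 (dagScale_le hw)
    have hv : 0 < 1 / (2 * w) ^ ((1 : ℝ) / 3) := by positivity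
    have hv3 : 1 / (2 * w) = (1 / (2 * w) ^ ((1 : ℝ) / 3)) ^ 3 := by
      rw [div_pow, rpow_third_pow_three (by linarith), one_pow]
    have hu3 : 1 / dagScale w ^ 3 = (1 / dagScale w) ^ 3 := by rw [div_pow, one_pow]
    have hu : 1 / dagScale w * dagScale w = 1 := by field_simp
    rw [hv3, hu3]
    generalize 1 / (2 * w) ^ ((1 : ℝ) / 3) = v at *
    generalize 1 / dagScale w = u at *
    have h3 : (u - v) * u ^ 2 ≤ u ^ 3 - v ^ 3 := by
      nlinarith [mul_nonneg hv.le (mul_nonneg (sub_nonneg.mpr h) (hv.le.trans h)),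
        mul_nonneg (sq_nonneg v) (sub_nonneg.mpr h)]
    calc u - v = (u - v) * u ^ 2 * dagScale w ^ 2 := by
          rw [mul_assoc, ← mul_pow, hu]
          ring
      _ ≤ _ := by gcongr

/-- The root of the deformed exponential attached to the rescaled root `s`. -/
noncomputable def dagRoot (s w : ℝ) : ℝ :=
  (1 - s * dagScale w ^ 2 / 2) * (2 / dagScale w ^ 3) / (√(1 + w) * Real.exp 1)

theorem dagRoot_spec (s : ℝ) {w : ℝ} (hw : 0 < w) :
    ((dagRoot s w : ℝ) : ℂ) * (√(1 + w) : ℂ) * Complex.exp 1 =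
      (1 - (s : ℂ) * (dagScale w : ℂ) ^ 2 / 2) * (2 / (dagScale w : ℂ) ^ 3) := by
  have h1 : 0 < √(1 + w) := Real.sqrt_pos.mpr (by linarith)
  have h : dagRoot s w * √(1 + w) * Real.exp 1 =
      (1 - s * dagScale w ^ 2 / 2) * (2 / dagScale w ^ 3) := by
    rw [dagRoot, mul_assoc, div_mul_cancel₀ _ (by positivity)]
  have h' := congrArg (fun x : ℝ => (x : ℂ)) h
  push_cast at h'
  exact h'

theorem two_mul_rpow_third_sq {w : ℝ} (hw : 0 < w) :
    2 ^ (-(1 : ℝ) / 3) * w ^ ((2 : ℝ) / 3) = ((2 * w) ^ ((1 : ℝ) / 3)) ^ 2 / 2 := by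
  rw [← Real.rpow_natCast, ← Real.rpow_mul (by linarith), Real.mul_rpow zero_le_two hw.le,
    show -(1 : ℝ) / 3 = 2 / 3 - 1 by norm_num, Real.rpow_sub_one two_ne_zero]
  norm_num
  ring

theorem abs_dagRoot_sub_le {a K s w : ℝ} (hw : 0 < w) (hw1 : w ≤ 1) (hκ1 : dagScale w ≤ 1)
    (hs : |s - (a + dagScale w / 6)| ≤ K * dagScale w ^ 2) :
    |Real.exp 1 * w * dagRoot s w -
        (1 - 2 ^ (-(1 : ℝ) / 3) * a * w ^ ((2 : ℝ) / 3) - w / 6)| ≤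
      (2 * |a| + 9 * K + 3) * w ^ ((4 : ℝ) / 3) := by
  obtain ⟨hα, hαw, hαl⟩ := log_one_add_bounds hw
  obtain ⟨hD1, hD2⟩ := div_log_one_add_mul_sqrt_bounds hw
  have hκ := dagScale_pos hw
  have hκX := dagScale_le hw
  have hκ3 := dagScale_pow_three hw
  have hX3 := rpow_third_pow_three (x := 2 * w) (by linarith)
  have hlead := two_mul_rpow_third_sq hw
  have hX : 0 < (2 * w) ^ ((1 : ℝ) / 3) := Real.rpow_pos_of_pos (by linarith) _
  have hroot : Real.exp 1 * w * dagRoot s w =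
      (1 - s * dagScale w ^ 2 / 2) * (w / (Real.log (1 + w) * √(1 + w))) := by
    have h1 : 0 < √(1 + w) := Real.sqrt_pos.mpr (by linarith)
    rw [dagRoot, hκ3]
    field_simp
  have hX4 : ((2 * w) ^ ((1 : ℝ) / 3)) ^ 4 ≤ 4 * w ^ ((4 : ℝ) / 3) := by
    rw [← Real.rpow_natCast, ← Real.rpow_mul (by linarith), Real.mul_rpow zero_le_two hw.le,
      show (1 : ℝ) / 3 * (4 : ℕ) = 4 / 3 by norm_num]
    gcongr
    calc (2 : ℝ) ^ ((4 : ℝ) / 3) ≤ 2 ^ (2 : ℝ) :=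
          Real.rpow_le_rpow_of_exponent_le one_le_two (by norm_num)
      _ = 4 := by norm_num
  have hw2 : w ^ 2 ≤ w ^ ((4 : ℝ) / 3) := by
    rw [← Real.rpow_natCast]
    exact Real.rpow_le_rpow_of_exponent_ge hw hw1 (by norm_num)
  have hαw2 : w - Real.log (1 + w) ≤ w ^ 2 / 2 := by
    have : w - w ^ 2 / 2 ≤ 2 * w / (w + 2) := by
      rw [le_div_iff₀ (by linarith)]
      nlinarith [pow_pos hw 3]
    linarith
  rw [show 2 ^ (-(1 : ℝ) / 3) * a * w ^ ((2 : ℝ) / 3) =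
    a * (2 ^ (-(1 : ℝ) / 3) * w ^ ((2 : ℝ) / 3)) by ring, hlead, hroot]
  generalize w / (Real.log (1 + w) * √(1 + w)) = D at *
  generalize (2 * w) ^ ((1 : ℝ) / 3) = X at *
  generalize w ^ ((4 : ℝ) / 3) = T at *
  generalize dagScale w = κ at *
  generalize Real.log (1 + w) = α at *
  have hK : 0 ≤ K := by
    have := (abs_nonneg _).trans hs
    exact nonneg_of_mul_nonneg_left this (by positivity)
  have hκsq : κ ^ 2 ≤ 1 := pow_le_one₀ hκ.le hκ1
  have hsabs : |s| ≤ |a| + 1 + K := by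
    have h1 : |s| ≤ |s - (a + κ / 6)| + |a| + κ / 6 := by
      have := abs_add_three (s - (a + κ / 6)) a (κ / 6)
      rw [abs_of_pos (show 0 < κ / 6 by positivity)] at this
      rwa [show s - (a + κ / 6) + a + κ / 6 = s by ring] at this
    nlinarith
  have hT : 0 ≤ T := (sq_nonneg w).trans hw2
  have hXκ : X ^ 2 - κ ^ 2 ≤ 2 * T := by
    have h : (X ^ 2 - κ ^ 2) * X ≤ 2 * T * X := by
      have hX2 : X ≤ 2 := by
        by_contra! hc
        have : 2 ^ 3 < X ^ 3 := by gcongr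
        linarith
      have h1 : X * X ^ 4 * X ≤ X * (4 * T) * 2 := by gcongr
      have h2 : w ^ 2 = X * X ^ 4 * X / 4 := by
        linear_combination (-X ^ 3 / 4 - w / 2) * hX3
      have h3 : 0 ≤ κ ^ 2 * (X - κ) := mul_nonneg (sq_nonneg κ) (sub_nonneg.mpr hκX)
      linarith
    exact le_of_mul_le_mul_right h hX
  have e1 : |(1 - s * κ ^ 2 / 2) * (D - 1)| ≤ (|a| + 2 + K) * T := by
    rw [abs_mul, abs_of_nonneg (by linarith : 0 ≤ D - 1)]
    have : |1 - s * κ ^ 2 / 2| ≤ |a| + 2 + K := by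
      refine (abs_sub _ _).trans ?_
      rw [abs_one, abs_div, abs_mul, abs_of_nonneg (sq_nonneg κ), abs_two]
      nlinarith [abs_nonneg s]
    gcongr
    linarith
  have e2 : |(s - (a + κ / 6)) * (κ ^ 2 / 2)| ≤ 2 * K * T := by
    rw [abs_mul, abs_of_pos (show 0 < κ ^ 2 / 2 by positivity)]
    have hκ4 : κ ^ 4 ≤ X ^ 4 := by gcongr
    calc |s - (a + κ / 6)| * (κ ^ 2 / 2) ≤ K * κ ^ 2 * (κ ^ 2 / 2) := by gcongr
      _ = K / 2 * κ ^ 4 := by ring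
      _ ≤ K / 2 * (4 * T) := by gcongr; linarith
      _ = 2 * K * T := by ring
  have e3 : |a * ((X ^ 2 - κ ^ 2) / 2)| ≤ |a| * T := by
    have : 0 ≤ X ^ 2 - κ ^ 2 := sub_nonneg.mpr (by gcongr)
    rw [abs_mul, abs_of_nonneg (by positivity : 0 ≤ (X ^ 2 - κ ^ 2) / 2)]
    gcongr
    linarith
  have e4 : |(w - α) / 6| ≤ T := by
    rw [abs_of_nonneg (by linarith)]
    linarith
  have hsplit : (1 - s * κ ^ 2 / 2) * D - (1 - a * (X ^ 2 / 2) - w / 6) =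
      (1 - s * κ ^ 2 / 2) * (D - 1) - (s - (a + κ / 6)) * (κ ^ 2 / 2) +
        a * ((X ^ 2 - κ ^ 2) / 2) + (w - α) / 6 := by
    linear_combination (-1 / 12) * hκ3
  rw [hsplit]
  rw [abs_le] at *
  constructor <;> nlinarith

theorem dagScale_prefactor_eq {w : ℝ} (hw : 0 < w) :
    dagScale w ^ 2 / √(Real.pi * dagScale w ^ 3) * (2 * Real.pi) =
      √(dagScale w / (2 * w) ^ ((1 : ℝ) / 3)) *
        (√(2 * Real.pi) * 2 ^ ((2 : ℝ) / 3) * w ^ ((1 : ℝ) / 6)) := by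
  have hκ := dagScale_pos hw
  have hπ := Real.pi_pos
  have hX : 0 < (2 * w) ^ ((1 : ℝ) / 3) := Real.rpow_pos_of_pos (by linarith) _
  refine (sq_eq_sq₀ (by positivity) (by positivity)).mp ?_
  have hw6 : (w ^ ((1 : ℝ) / 6)) ^ 2 = w ^ ((1 : ℝ) / 3) := by
    rw [← Real.rpow_natCast, ← Real.rpow_mul hw.le]
    norm_num
  have h2 : ((2 : ℝ) ^ ((2 : ℝ) / 3)) ^ 2 = 2 * 2 ^ ((1 : ℝ) / 3) := by
    rw [← Real.rpow_natCast, ← Real.rpow_mul zero_le_two, ← Real.rpow_one_add' zero_le_two]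
    all_goals norm_num
  simp only [mul_pow, div_pow]
  rw [Real.sq_sqrt (by positivity), Real.sq_sqrt (by positivity), Real.sq_sqrt (by positivity),
    hw6, h2, Real.mul_rpow zero_le_two hw.le]
  have : 0 < w ^ ((1 : ℝ) / 3) := Real.rpow_pos_of_pos hw _
  field_simp

theorem tendsto_dagScale_exponent {a K : ℝ} {s : ℝ → ℝ}
    (hs : ∀ᶠ w in 𝓝[>] 0, |s w - (a + dagScale w / 6)| ≤ K * dagScale w ^ 2) :
    Tendsto (fun w => (1 - 1 / dagScale w ^ 3 + s w / dagScale w) -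
      (11 / 12 - 1 / (2 * w) + a / (2 * w) ^ ((1 : ℝ) / 3))) (𝓝[>] 0) (𝓝 0) := by
  have hκ : Tendsto dagScale (𝓝[>] 0) (𝓝 0) := tendsto_dagScale.mono_right nhdsWithin_le_nhds
  have hrem : Tendsto (fun w => (s w - (a + dagScale w / 6)) / dagScale w) (𝓝[>] 0) (𝓝 0) := by
    refine squeeze_zero_norm' (a := fun w => K * dagScale w) ?_ (by simpa using hκ.const_mul K)
    filter_upwards [hs, self_mem_nhdsWithin] with w hw hw0
    have hκ0 := dagScale_pos hw0
    rw [norm_div, Real.norm_eq_abs, Real.norm_eq_abs, abs_of_pos hκ0, div_le_iff₀ hκ0]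
    linarith
  have h := ((tendsto_const_nhds (x := (1 : ℝ) / 4)).sub
    tendsto_inv_dagScale_pow_three_sub).add (hrem.add (tendsto_inv_dagScale_sub.const_mul a))
  norm_num only [mul_zero, sub_self, add_zero] at h
  refine h.congr' ?_
  filter_upwards [self_mem_nhdsWithin] with w hw0
  have hκ0 := dagScale_pos hw0
  have : (s w - (a + dagScale w / 6)) / dagScale w =
      s w / dagScale w - a / dagScale w - 1 / 6 := by
    field_simp
    ring
  rw [this]
  ring

theorem tendsto_of_abs_sub_dagScale_le {a K : ℝ} {s : ℝ → ℝ}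
    (hs : ∀ᶠ w in 𝓝[>] 0, |s w - (a + dagScale w / 6)| ≤ K * dagScale w ^ 2) :
    Tendsto s (𝓝[>] 0) (𝓝 a) := by
  have hκ : Tendsto dagScale (𝓝[>] 0) (𝓝 0) := tendsto_dagScale.mono_right nhdsWithin_le_nhds
  have h1 : Tendsto (fun w => s w - (a + dagScale w / 6)) (𝓝[>] 0) (𝓝 0) :=
    squeeze_zero_norm' hs (by simpa using (hκ.pow 2).const_mul K)
  have h2 := h1.add ((hκ.div_const 6).const_add a)
  simpa using h2

theorem neg_mul_eq_mul_of_mul_two_pi_eq {M P Q S c W : ℂ} (hM : M ≠ 0)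
    (h : P * (2 * (Real.pi : ℂ)) = Q * (S * c * W)) (R E₁ E₂ Δ D : ℂ) :
    -(P * R * (Δ * (E₁ * E₂)) * D) = Q * R * Δ * (D / -M) *
      (-(S * c * E₁ * -(1 / (2 * (Real.pi : ℂ)) * M)) * W * E₂) := by
  have hπ : (Real.pi : ℂ) ≠ 0 := Complex.ofReal_ne_zero.mpr Real.pi_ne_zero
  have hP : P = Q * (S * c * W) / (2 * (Real.pi : ℂ)) := by
    rw [← h]
    field_simp
  rw [hP]
  field_simp

theorem two_cpow_two_thirds : (2 : ℂ) ^ ((2 : ℂ) / 3) = (((2 : ℝ) ^ ((2 : ℝ) / 3) : ℝ) : ℂ) := by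
  rw [Complex.ofReal_cpow zero_le_two]
  push_cast
  rfl

theorem two_cpow_neg_third_mul_div (a : ℝ) {w : ℝ} (hw : 0 < w) :
    (2 : ℂ) ^ (-(1 : ℂ) / 3) * (a : ℂ) / ((w ^ ((1 : ℝ) / 3) : ℝ) : ℂ) =
      ((a / (2 * w) ^ ((1 : ℝ) / 3) : ℝ) : ℂ) := by
  have h : (2 : ℂ) ^ (-(1 : ℂ) / 3) = ((((2 : ℝ) ^ ((1 : ℝ) / 3))⁻¹ : ℝ) : ℂ) := by
    rw [← Real.rpow_neg zero_le_two, Complex.ofReal_cpow zero_le_two]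
    push_cast
    rw [neg_div]
  rw [h, Real.mul_rpow zero_le_two hw.le, Complex.ofReal_div, Complex.ofReal_mul,
    Complex.ofReal_inv]
  field_simp

/-- The elementary factor in the quotient of `∂_z φ̃` by its leading asymptotics. -/
noncomputable def dagRatio (a s w : ℝ) : ℝ :=
  √(dagScale w / (2 * w) ^ ((1 : ℝ) / 3)) * √(1 + w) *
    Real.exp ((1 - 1 / dagScale w ^ 3 + s / dagScale w) -
      (11 / 12 - 1 / (2 * w) + a / (2 * w) ^ ((1 : ℝ) / 3)))

theorem tendsto_dagRatio {a K : ℝ} {s : ℝ → ℝ}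
    (hs : ∀ᶠ w in 𝓝[>] 0, |s w - (a + dagScale w / 6)| ≤ K * dagScale w ^ 2) :
    Tendsto (fun w => dagRatio a (s w) w) (𝓝[>] 0) (𝓝 1) := by
  have h1 : Tendsto (fun w : ℝ => √(1 + w)) (𝓝[>] 0) (𝓝 1) := by
    have h : ContinuousAt (fun w : ℝ => √(1 + w)) 0 := by fun_prop
    simpa using h.tendsto.mono_left (nhdsWithin_le_nhds (s := Set.Ioi 0))
  have h := (tendsto_dagScale_div.sqrt.mul h1).mul (tendsto_dagScale_exponent hs).rexp
  simpa only [Real.sqrt_one, mul_one, Real.exp_zero, dagRatio] using h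

theorem deriv_phiTilde_dagRoot {a s w : ℝ} (hM : airyMoment 1 (a : ℂ) ≠ 0) (hw : 0 < w)
    (hκ1 : dagScale w ≤ 1) (hz : dagIntegral (s : ℂ) (dagScale w) = 0) :
    deriv (fun ζ => phiTilde ζ w) ((dagRoot s w : ℝ) : ℂ) =
      (dagRatio a s w : ℂ) *
        (dagIntegralDeriv (s : ℂ) (dagScale w) / -airyMoment 1 (a : ℂ)) *
      (-((Real.sqrt (2 * Real.pi) : ℂ) * (2 : ℂ) ^ ((2 : ℂ) / 3) *
            Complex.exp (11 / 12) * airyAi' (a : ℂ)) *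
          ((w ^ ((1 : ℝ) / 6) : ℝ) : ℂ) *
          Complex.exp (-1 / (2 * (w : ℂ))
            + (2 : ℂ) ^ (-(1 : ℂ) / 3) * (a : ℂ) / ((w ^ ((1 : ℝ) / 3) : ℝ) : ℂ))) := by
  have hκ := dagScale_pos hw
  have hlog : Real.log (1 + w) = dagScale w ^ 3 / 2 := by
    rw [dagScale_pow_three hw]
    ring
  have hpre := congrArg (fun x : ℝ => (x : ℂ)) (dagScale_prefactor_eq hw)
  have hexp : Complex.exp (1 - 1 / (dagScale w : ℂ) ^ 3 + (s : ℂ) / dagScale w) =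
      ((Real.exp ((1 - 1 / dagScale w ^ 3 + s / dagScale w) -
        (11 / 12 - 1 / (2 * w) + a / (2 * w) ^ ((1 : ℝ) / 3))) : ℝ) : ℂ) *
      (Complex.exp (11 / 12) * Complex.exp (-1 / (2 * (w : ℂ)) +
        ((a / (2 * w) ^ ((1 : ℝ) / 3) : ℝ) : ℂ))) := by
    rw [Complex.ofReal_exp, ← Complex.exp_add, ← Complex.exp_add]
    congr 1
    push_cast
    ring
  rw [deriv_phiTilde_eq hκ hκ1 hlog (dagRoot_spec s hw) hz, airyAi'_eq_airyMoment,
    two_cpow_two_thirds, two_cpow_neg_third_mul_div a hw, hexp, dagRatio]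
  simp only [Complex.ofReal_mul _ _, Complex.ofReal_ofNat] at hpre ⊢
  rw [← Complex.ofReal_pow, ← Complex.ofReal_div]
  exact neg_mul_eq_mul_of_mul_two_pi_eq hM hpre _ _ _ _ _

theorem isEquivalent_deriv_phiTilde {a K : ℝ} (ha : airyMoment 0 (a : ℂ) = 0) {s : ℝ → ℝ}
    (hs : ∀ᶠ w in 𝓝[>] 0, |s w - (a + dagScale w / 6)| ≤ K * dagScale w ^ 2)
    (hzero : ∀ᶠ w in 𝓝[>] 0, dagIntegral (s w : ℂ) (dagScale w) = 0) :
    Asymptotics.IsEquivalent (𝓝[>] (0 : ℝ))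
      (fun w => deriv (fun ζ => phiTilde ζ w) ((dagRoot (s w) w : ℝ) : ℂ))
      (fun w =>
        -((Real.sqrt (2 * Real.pi) : ℂ) * (2 : ℂ) ^ ((2 : ℂ) / 3) *
            Complex.exp (11 / 12) * airyAi' (a : ℂ)) *
          ((w ^ ((1 : ℝ) / 6) : ℝ) : ℂ) *
          Complex.exp (-1 / (2 * (w : ℂ))
            + (2 : ℂ) ^ (-(1 : ℂ) / 3) * (a : ℂ) / ((w ^ ((1 : ℝ) / 3) : ℝ) : ℂ))) := by
  have hM := airyMoment_one_ne_zero ha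
  have hsC : Tendsto (fun w => (s w : ℂ)) (𝓝[>] (0 : ℝ)) (𝓝 (a : ℂ)) :=
    Tendsto.comp (Complex.continuous_ofReal.tendsto a) (tendsto_of_abs_sub_dagScale_le hs)
  have hD : Tendsto (fun w => dagIntegralDeriv (s w : ℂ) (dagScale w)) (𝓝[>] 0)
      (𝓝 (-airyMoment 1 (a : ℂ))) := by
    have hpair : Tendsto (fun w => ((s w : ℂ), dagScale w)) (𝓝[>] (0 : ℝ))
        (𝓝 (a : ℂ) ×ˢ 𝓝[>] (0 : ℝ)) := hsC.prodMk tendsto_dagScale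
    have h := Tendsto.comp (tendsto_dagIntegralDeriv (a : ℂ)) hpair
    simpa only [Function.comp_def] using h
  refine Asymptotics.isEquivalent_iff_exists_eq_mul.mpr ⟨fun w => (dagRatio a (s w) w : ℂ) *
    (dagIntegralDeriv (s w : ℂ) (dagScale w) / -airyMoment 1 (a : ℂ)), ?_, ?_⟩
  · have h := ((Complex.continuous_ofReal.tendsto 1).comp (tendsto_dagRatio hs)).mul
      (hD.div_const (-airyMoment 1 (a : ℂ)))
    rw [div_self (neg_ne_zero.mpr hM)] at h
    simpa using h
  · have hκ1 : ∀ᶠ w in 𝓝[>] (0 : ℝ), dagScale w < 1 :=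
      (tendsto_dagScale.mono_right nhdsWithin_le_nhds).eventually_lt_const one_pos
    filter_upwards [hzero, hκ1, self_mem_nhdsWithin] with w hz hκ1 hw
    rw [Pi.mul_apply]
    exact deriv_phiTilde_dagRoot hM hw hκ1.le hz

end

/-- Zeros of `φ̃` near the critical point and derivatives there: there is a root
`ϱ̃(w)` with `ϱ̃(w) = (1/(ew))(1 − 2^{−1/3}a·w^{2/3} − w/6 + O(w^{4/3}))` and
`∂_z φ̃(ϱ̃(w), w) ∼ −√(2π)·2^{2/3}·e^{11/12}·Ai'(a)·w^{1/6}·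
exp(−1/(2w) + 2^{−1/3}a/w^{1/3})` as `w → 0⁺`,
where `a` is a real zero of the Airy function. -/
theorem phiTilde_zeros_and_derivative (a : ℝ) (ha : airyAi (a : ℂ) = 0) :
    ∃ w₀ > (0 : ℝ), ∃ ϱ : ℝ → ℝ,
      (∀ w ∈ Set.Ioo (0 : ℝ) w₀, phiTilde ((ϱ w : ℝ) : ℂ) w = 0) ∧
      ((fun w => Real.exp 1 * w * ϱ w -
          (1 - 2 ^ (-(1 : ℝ) / 3) * a * w ^ ((2 : ℝ) / 3) - w / 6))
        =O[𝓝[>] (0 : ℝ)] fun w => w ^ ((4 : ℝ) / 3)) ∧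
      Asymptotics.IsEquivalent (𝓝[>] (0 : ℝ))
        (fun w => deriv (fun ζ => phiTilde ζ w) ((ϱ w : ℝ) : ℂ))
        (fun w =>
          -((Real.sqrt (2 * Real.pi) : ℂ) * (2 : ℂ) ^ ((2 : ℂ) / 3) *
              Complex.exp (11 / 12) * airyAi' (a : ℂ)) *
            ((w ^ ((1 : ℝ) / 6) : ℝ) : ℂ) *
            Complex.exp (-1 / (2 * (w : ℂ))
              + (2 : ℂ) ^ (-(1 : ℂ) / 3) * (a : ℂ) / ((w ^ ((1 : ℝ) / 3) : ℝ) : ℂ))) := by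
  have hM : airyMoment 0 (a : ℂ) = 0 := by
    rw [airyAi_eq_airyMoment, mul_eq_zero] at ha
    refine ha.resolve_left ?_
    simp [Real.pi_ne_zero]
  obtain ⟨κ₁, hκ₁, hκ₁1, K, hroots⟩ := exists_dagIntegral_eq_zero hM
  choose! S hS0 hSK using hroots
  have hκ : ∀ᶠ w in 𝓝[>] (0 : ℝ), dagScale w < κ₁ :=
    (tendsto_dagScale.mono_right nhdsWithin_le_nhds).eventually_lt_const hκ₁
  obtain ⟨w₀, hw₀, hsmall⟩ := mem_nhdsGT_iff_exists_Ioo_subset.mp hκ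
  refine ⟨w₀, hw₀, fun w => dagRoot (S (dagScale w)) w, ?_, ?_, ?_⟩
  · intro w hw
    have hlt : dagScale w < κ₁ := hsmall hw
    have hpos := dagScale_pos hw.1
    rw [phiTilde_eq_dagIntegral hpos (hlt.le.trans hκ₁1)
      (by rw [dagScale_pow_three hw.1]; ring) (dagRoot_spec _ hw.1), hS0 _ hpos hlt, mul_zero]
  · refine Asymptotics.IsBigO.of_bound (2 * |a| + 9 * K + 3) ?_
    have h1 : ∀ᶠ w in 𝓝[>] (0 : ℝ), w < 1 :=
      (tendsto_id.mono_left nhdsWithin_le_nhds).eventually_lt_const one_pos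
    filter_upwards [hκ, h1, self_mem_nhdsWithin] with w hlt hw1 (hw : 0 < w)
    rw [Real.norm_eq_abs, Real.norm_of_nonneg (Real.rpow_nonneg hw.le _)]
    exact abs_dagRoot_sub_le hw hw1.le (hlt.le.trans hκ₁1) (hSK _ (dagScale_pos hw) hlt)
  · refine isEquivalent_deriv_phiTilde hM (K := K) (s := fun w => S (dagScale w)) ?_ ?_
    · filter_upwards [hκ, self_mem_nhdsWithin] with w hlt hw
      exact hSK _ (dagScale_pos hw) hlt
    · filter_upwards [hκ, self_mem_nhdsWithin] with w hlt hw
      exact hS0 _ (dagScale_pos hw) hlt
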